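/- arXiv:1702.06169 — 7 statements merged into one kernel-verified Lean document; each statement's English description precedes it below -/
import Mathlib

section
/- A matrix X ∈ M with trace zero commutes with Λ if and only if X is a finite ℂ-linear combination of the powers Λ^r with r ∈ ℤ and r not divisible by 2n+1. (Equivalently: the centralizer of Λ in sl_{2n+1}(ℂ[λ,λ⁻¹]) is the ℂ-span of {Λ^r : r ∈ ℤ, r ≢ 0 mod 2n+1}, which is the realization of the abelian subalgebra z(A_{2n}^{(1)}).) -/
/-!
Context: fix `n ≥ 2`; work in the algebra `Mat n` of `(2n+1)×(2n+1)` matrices over the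
ring `ℂ[λ,λ⁻¹]` of Laurent polynomials; `Λ = Σ_{i=1}^{2n} e_{i+1,i} + λ·e_{1,2n+1}` with
inverse `Λ⁻¹ = Σ_{i=1}^{2n} e_{i,i+1} + λ⁻¹·e_{2n+1,1}`.

STATEMENT 1: a matrix `X ∈ Mat n` with trace zero commutes with `Λ` if and only if `X` is
a finite ℂ-linear combination of the powers `Λ^r` with `r : ℤ` not divisible by `2n+1`.
-/

noncomputable section

abbrev Mat (n : ℕ) := Matrix (Fin (2*n+1)) (Fin (2*n+1)) (LaurentPolynomial ℂ)

/-- The matrix unit `e_{k,l}`, `1 ≤ k, l ≤ 2n+1` (1-based indices). -/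
def eM (n : ℕ) (k l : ℕ) : Mat n :=
  Matrix.of fun a b => if (a : ℕ) + 1 = k ∧ (b : ℕ) + 1 = l then 1 else 0

/-- `Λ = Σ_{i=1}^{2n} e_{i+1,i} + λ·e_{1,2n+1}`. -/
def Lam (n : ℕ) : Mat n :=
  (∑ i ∈ Finset.Icc 1 (2*n), eM n (i+1) i) +
    (LaurentPolynomial.T 1 : LaurentPolynomial ℂ) • eM n 1 (2*n+1)

/-- `Λ⁻¹ = Σ_{i=1}^{2n} e_{i,i+1} + λ⁻¹·e_{2n+1,1}`. -/
def LamInv (n : ℕ) : Mat n :=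
  (∑ i ∈ Finset.Icc 1 (2*n), eM n i (i+1)) +
    (LaurentPolynomial.T (-1) : LaurentPolynomial ℂ) • eM n (2*n+1) 1

/-- `Λ^r` for `r : ℤ`, negative powers taken using the inverse `LamInv`. -/
def Lzpow (n : ℕ) (r : ℤ) : Mat n :=
  if 0 ≤ r then Lam n ^ r.toNat else LamInv n ^ (-r).toNat

open LaurentPolynomial in
/-- Explicit form of the powers. -/
def GG (n : ℕ) (r : ℤ) : Mat n :=
  Matrix.of fun a b => if (2*(n:ℤ)+1) ∣ (r + (b:ℕ) - (a:ℕ)) then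
    (T ((r + (b:ℕ) - (a:ℕ)) / (2*(n:ℤ)+1)) : LaurentPolynomial ℂ) else 0

theorem GG_apply (n : ℕ) (r : ℤ) (a b : Fin (2*n+1)) :
    GG n r a b = if (2*(n:ℤ)+1) ∣ (r + (b:ℕ) - (a:ℕ)) then
    (LaurentPolynomial.T ((r + (b:ℕ) - (a:ℕ)) / (2*(n:ℤ)+1)) : LaurentPolynomial ℂ) else 0 := rfl

theorem fin_eq_of_dvd (n : ℕ) (a b : Fin (2*n+1)) (h : (2*(n:ℤ)+1) ∣ ((a:ℕ):ℤ) - (b:ℕ)) :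
    a = b := by
  have ha := a.2
  have hb := b.2
  have := Int.eq_zero_of_abs_lt_dvd h (by rw [abs_lt]; constructor <;> omega)
  ext; omega

theorem GG_mul (n : ℕ) (r s : ℤ) : GG n r * GG n s = GG n (r+s) := by
  have hN : (0:ℤ) < 2*(n:ℤ)+1 := by positivity
  ext1 a b
  have h0 := Int.emod_nonneg (s + (b:ℕ)) hN.ne'
  have h1 := Int.emod_lt_of_pos (s + (b:ℕ)) hN
  let c : Fin (2*n+1) := ⟨((s + (b:ℕ)) % (2*(n:ℤ)+1)).toNat, by omega⟩
  have hc : (((c : Fin (2*n+1)) : ℕ) : ℤ) = (s + (b:ℕ)) % (2*(n:ℤ)+1) := by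
    simp only [c]; omega
  have hd : (2*(n:ℤ)+1) ∣ (s + (b:ℕ) - (c:ℕ)) := by
    rw [hc]; exact Int.dvd_self_sub_emod
  rw [Matrix.mul_apply, Finset.sum_eq_single c]
  · rw [GG_apply n s, if_pos hd, GG_apply, GG_apply]
    have e : (r + s + (b:ℕ) - (a:ℕ)) = (r + (c:ℕ) - (a:ℕ)) + (s + (b:ℕ) - (c:ℕ)) := by ring
    by_cases h : (2*(n:ℤ)+1) ∣ (r + (c:ℕ) - (a:ℕ))
    · rw [if_pos h, if_pos (by rw [e]; exact dvd_add h hd), ← LaurentPolynomial.T_add, e,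
        Int.add_ediv_of_dvd_left h]
    · rw [if_neg h, if_neg, zero_mul]
      rw [e]; intro h'; exact h ((dvd_add_left hd).1 h')
  · intro x _ hx
    rw [GG_apply n s, if_neg, mul_zero]
    intro h
    apply hx
    apply fin_eq_of_dvd
    have := dvd_sub hd h
    have e2 : ((x:ℕ):ℤ) - (c:ℕ) = (s + (b:ℕ) - (c:ℕ)) - (s + (b:ℕ) - (x:ℕ)) := by ring
    rw [e2]; exact this
  · simp

theorem GG_zero (n : ℕ) : GG n 0 = 1 := by
  ext1 a b
  rw [GG_apply, Matrix.one_apply]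
  by_cases h : a = b
  · subst h; simp
  · rw [if_neg, if_neg h]
    intro h'
    exact h (fin_eq_of_dvd n b a (by simpa using h')).symm

theorem Lam_eq (n : ℕ) : Lam n = GG n 1 := by
  ext1 a b
  have ha := a.2
  have hb := b.2
  rw [GG_apply]
  simp only [Lam, Matrix.add_apply, Matrix.sum_apply, eM, Matrix.of_apply, Matrix.smul_apply]
  by_cases h : (b:ℕ) = 2*n
  · rw [Finset.sum_eq_zero]
    · by_cases h2 : (a:ℕ) = 0
      · have : (1 + ((b:ℕ):ℤ) - (a:ℕ)) = 2*(n:ℤ)+1 := by omega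
        rw [this, Int.ediv_self (by omega)]; simp [h, h2]
      · rw [if_neg (by omega), if_neg]
        · simp
        · intro hd
          have := Int.eq_zero_of_abs_lt_dvd hd (by rw [abs_lt]; constructor <;> omega)
          omega
    · intro i hi
      rw [Finset.mem_Icc] at hi
      rw [if_neg (by omega)]
  · rw [Finset.sum_eq_single ((b:ℕ)+1)]
    · rw [if_neg (c := (a:ℕ)+1 = 1 ∧ (b:ℕ)+1 = 2*n+1) (by omega)]
      by_cases h2 : (a:ℕ) = b + 1
      · have : (1 + ((b:ℕ):ℤ) - (a:ℕ)) = 0 := by omega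
        rw [this]; simp [h2]
      · rw [if_neg (by omega), if_neg]
        · simp
        · intro hd
          have := Int.eq_zero_of_abs_lt_dvd hd (by rw [abs_lt]; constructor <;> omega)
          omega
    · intro i _ hi
      rw [if_neg (by omega)]
    · intro hi
      exact absurd (Finset.mem_Icc.2 (by omega)) hi

theorem LamInv_eq (n : ℕ) : LamInv n = GG n (-1) := by
  ext1 a b
  have ha := a.2
  have hb := b.2
  rw [GG_apply]
  simp only [LamInv, Matrix.add_apply, Matrix.sum_apply, eM, Matrix.of_apply, Matrix.smul_apply]
  by_cases h : (a:ℕ) = 2*n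
  · rw [Finset.sum_eq_zero]
    · by_cases h2 : (b:ℕ) = 0
      · have : (-1 + ((b:ℕ):ℤ) - (a:ℕ)) = -(2*(n:ℤ)+1) := by omega
        rw [this, Int.neg_ediv_of_dvd dvd_rfl, Int.ediv_self (by omega), if_pos (dvd_neg.2 dvd_rfl)]
        simp [h, h2]
      · rw [if_neg (by omega), if_neg]
        · simp
        · intro hd
          have := Int.eq_zero_of_abs_lt_dvd hd (by rw [abs_lt]; constructor <;> omega)
          omega
    · intro i hi
      rw [Finset.mem_Icc] at hi
      rw [if_neg (by omega)]
  · rw [Finset.sum_eq_single ((a:ℕ)+1)]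
    · rw [if_neg (c := (a:ℕ)+1 = 2*n+1 ∧ (b:ℕ)+1 = 1) (by omega)]
      by_cases h2 : (b:ℕ) = a + 1
      · have : (-1 + ((b:ℕ):ℤ) - (a:ℕ)) = 0 := by omega
        rw [this]; simp [h2]
      · rw [if_neg (by omega), if_neg]
        · simp
        · intro hd
          have := Int.eq_zero_of_abs_lt_dvd hd (by rw [abs_lt]; constructor <;> omega)
          omega
    · intro i _ hi
      rw [if_neg (by omega)]
    · intro hi
      exact absurd (Finset.mem_Icc.2 (by omega)) hi

theorem GG_pow (n : ℕ) (r : ℤ) (k : ℕ) : GG n r ^ k = GG n (k * r) := by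
  induction k with
  | zero => simp [GG_zero]
  | succ k ih => rw [pow_succ, ih, GG_mul]; congr 1; push_cast; ring

theorem Lzpow_eq (n : ℕ) (r : ℤ) : Lzpow n r = GG n r := by
  unfold Lzpow
  split_ifs with h
  · rw [Lam_eq, GG_pow]; congr 1; omega
  · rw [LamInv_eq, GG_pow]; congr 1; omega

theorem GG_col (n : ℕ) (b c : Fin (2*n+1)) : GG n (b:ℕ) c 0 = if c = b then 1 else 0 := by
  rw [GG_apply]
  by_cases h : c = b
  · subst h; simp
  · rw [if_neg, if_neg h]
    intro h'
    exact h (fin_eq_of_dvd n b c (by simpa using h')).symm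

theorem col_eq (n : ℕ) (X : Mat n) (hX : X * Lam n = Lam n * X) (a b : Fin (2*n+1)) :
    X a b = (GG n (b:ℕ) * X) a 0 := by
  have hc : Commute X (Lam n) := hX
  have h1 : X * GG n (b:ℕ) = GG n (b:ℕ) * X := by
    have := (hc.pow_right (b:ℕ)).eq
    rwa [Lam_eq, GG_pow, mul_one] at this
  rw [← h1, Matrix.mul_apply]
  simp [GG_col]

theorem T_smul_GG (n : ℕ) (m r : ℤ) :
    (LaurentPolynomial.T m : LaurentPolynomial ℂ) • GG n r = GG n (r + (2*(n:ℤ)+1) * m) := by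
  have hN : (2*(n:ℤ)+1) ≠ 0 := by positivity
  ext1 a b
  rw [Matrix.smul_apply, GG_apply, GG_apply]
  have e : r + (2*(n:ℤ)+1) * m + (b:ℕ) - (a:ℕ) = (r + (b:ℕ) - (a:ℕ)) + (2*(n:ℤ)+1) * m := by ring
  rw [e]
  by_cases h : (2*(n:ℤ)+1) ∣ (r + (b:ℕ) - (a:ℕ))
  · rw [if_pos h, if_pos (dvd_add h (dvd_mul_right _ _)), smul_eq_mul, ← LaurentPolynomial.T_add,
      Int.add_mul_ediv_left _ _ hN, add_comm]
  · rw [if_neg h, if_neg, smul_zero]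
    intro h'; exact h ((dvd_add_left (dvd_mul_right _ _)).1 h')

theorem smul_GG_mem (n : ℕ) (r : ℤ) (hr : ¬ ((2*(n:ℤ)+1) ∣ r)) (p : LaurentPolynomial ℂ) :
    p • GG n r ∈ Submodule.span ℂ
        {A : Mat n | ∃ r : ℤ, ¬ ((2*(n:ℤ)+1) ∣ r) ∧ A = Lzpow n r} := by
  induction p using LaurentPolynomial.induction_on' with
  | add p q hp hq => rw [add_smul]; exact Submodule.add_mem _ hp hq
  | C_mul_T m c =>
    have : (LaurentPolynomial.C c * LaurentPolynomial.T m : LaurentPolynomial ℂ) • GG n r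
        = c • GG n (r + (2*(n:ℤ)+1) * m) := by
      rw [← T_smul_GG, ← LaurentPolynomial.smul_eq_C_mul, smul_assoc]
    rw [this]
    apply Submodule.smul_mem
    apply Submodule.subset_span
    refine ⟨_, ?_, (Lzpow_eq n _).symm⟩
    intro h'; exact hr ((dvd_add_left (dvd_mul_right _ _)).1 h')

theorem stmt1 (n : ℕ) (hn : 2 ≤ n) (X : Mat n) (htr : X.trace = 0) :
    X * Lam n = Lam n * X ↔
      X ∈ Submodule.span ℂ
        {A : Mat n | ∃ r : ℤ, ¬ ((2*(n:ℤ)+1) ∣ r) ∧ A = Lzpow n r} := by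
  constructor
  · intro hX
    have hdiag : ∀ b, X b b = X 0 0 := by
      intro b
      rw [col_eq n X hX b b, Matrix.mul_apply, Finset.sum_eq_single 0]
      · rw [GG_col]; simp
      · intro c _ hc
        rw [GG_apply, if_neg, zero_mul]
        intro h
        apply hc
        apply fin_eq_of_dvd
        simpa using h
      · simp
    have h00 : X 0 0 = 0 := by
      rw [Matrix.trace] at htr
      simp only [Matrix.diag_apply, hdiag] at htr
      rw [Finset.sum_const, Finset.card_univ, Fintype.card_fin,
        ← Nat.cast_smul_eq_nsmul ℂ] at htr
      exact (smul_eq_zero.1 htr).resolve_left (Nat.cast_ne_zero.2 (Nat.succ_ne_zero (2*n)))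
    have key : X = ∑ k : Fin (2*n+1), X k 0 • GG n (k:ℕ) := by
      set Y : Mat n := ∑ k : Fin (2*n+1), X k 0 • GG n (k:ℕ) with hY
      have hYc : Y * Lam n = Lam n * Y := by
        rw [hY, Finset.sum_mul, Finset.mul_sum]
        refine Finset.sum_congr rfl fun k _ => ?_
        rw [Lam_eq, Matrix.smul_mul, Matrix.mul_smul, GG_mul, GG_mul, add_comm (1:ℤ)]
      have hcol : ∀ c, Y c 0 = X c 0 := by
        intro c
        rw [hY, Matrix.sum_apply]
        simp [GG_col]
      ext1 a b
      rw [col_eq n X hX a b, col_eq n Y hYc a b, Matrix.mul_apply, Matrix.mul_apply]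
      simp only [hcol]
    rw [key]
    refine Submodule.sum_mem _ fun k _ => ?_
    by_cases hk : k = 0
    · rw [hk, h00, zero_smul]; exact Submodule.zero_mem _
    · apply smul_GG_mem
      intro h
      apply hk
      apply fin_eq_of_dvd
      simpa using h
  · intro h
    clear htr
    induction h using Submodule.span_induction with
    | mem x hx =>
      obtain ⟨r, _, rfl⟩ := hx
      rw [Lzpow_eq, Lam_eq, GG_mul, GG_mul, add_comm (1:ℤ)]
    | zero => simp
    | add x y _ _ hx hy => rw [add_mul, mul_add, hx, hy]
    | smul c x _ hx => rw [smul_mul_assoc, mul_smul_comm, hx]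
end
end

section
/- Let v_1,…,v_{2n+1}, X_1,…,X_{2n+1} : ℝ → ℂ be smooth functions with Σ_{k=1}^{2n+1} v_k = 0, Σ_{k=1}^{2n+1} X_k = 0 and X_k + X_{2n+2−k} = 0 for all k. Fix i ∈ {1,…,2n+1}. Then there exist smooth functions Z_0,…,Z_{2n−2} : ℝ → ℂ such that for every smooth f : ℝ → ℂ one has Z^i f = Z_{2n−1}·f^{(2n−1)} + Σ_{j=0}^{2n−2} Z_j·f^{(j)}, where Z_{2n−1} = −( Σ_{k=1}^{2n+1} v_k·X_k + Σ_{k=1}^{i} (i−k)·X_k′ + Σ_{k=i+1}^{2n+1} (i+2n+1−k)·X_k′ ). -/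
/-!
Context: fix `n ≥ 2`.  For a smooth `w : ℝ → ℂ`, `Dop w` is the operator
`f ↦ f′ − w·f` on smooth complex functions, and `Mop X` is multiplication by `X`.
For `i ∈ {1,…,2n+1}` arrange the indices `1,…,2n+1` in the cyclic order
`i, i−1, …, 1, 2n+1, 2n, …, i+1` (position `p ∈ {0,…,2n}` carries the index
`cyc i p = if p < i then i − p else 2n+1+i−p`), and let
`Z^i = Σ_{k=1}^{2n+1}` (composition of the `2n+1` operators `D_{v_{cyc i p}}`,
`p = 0,…,2n` from outermost to innermost, with the factor `D_{v_k}` replaced by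
`M_{−X_k}`).

STATEMENT 7: if `v_k, X_k` are smooth with `Σ v_k = 0`, `Σ X_k = 0`,
`X_k + X_{2n+2−k} = 0`, then for each fixed `i ∈ {1,…,2n+1}` there are smooth functions
`Z_0,…,Z_{2n−2}` such that for every smooth `f`,
`Z^i f = Z_{2n−1}·f^{(2n−1)} + Σ_{j=0}^{2n−2} Z_j·f^{(j)}`, where
`Z_{2n−1} = −( Σ_{k=1}^{2n+1} v_k X_k + Σ_{k=1}^{i} (i−k) X_k′
             + Σ_{k=i+1}^{2n+1} (i+2n+1−k) X_k′ )`.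
-/

noncomputable section

/-- `D_w : f ↦ f′ − w f`. -/
def Dop (w : ℝ → ℂ) : (ℝ → ℂ) → (ℝ → ℂ) := fun f => deriv f - w * f

/-- `M_X : f ↦ X f`. -/
def Mop (X : ℝ → ℂ) : (ℝ → ℂ) → (ℝ → ℂ) := fun f => X * f

/-- The index at position `p` in the cyclic order `i, i−1, …, 1, 2n+1, 2n, …, i+1`. -/
def cyc (n i p : ℕ) : ℕ := if p < i then i - p else 2*n+1+i-p

/-- The operator `Z^i`: the sum over `k = 1,…,2n+1` of the composition
`D_{v_i}∘⋯∘D_{v_1}∘D_{v_{2n+1}}∘⋯∘D_{v_{i+1}}` with the factor `D_{v_k}` replaced by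
`M_{−X_k}`. -/
def Zop (n : ℕ) (v X : ℕ → ℝ → ℂ) (i : ℕ) : (ℝ → ℂ) → (ℝ → ℂ) := fun f =>
  ∑ k ∈ Finset.Icc 1 (2*n+1),
    ((List.range (2*n+1)).foldr
      (fun p g => (if cyc n i p = k then Mop (-(X k)) else Dop (v (cyc n i p))) ∘ g)
      id) f

def IsDO (m : ℕ) (a b : ℝ → ℂ) (T : (ℝ → ℂ) → (ℝ → ℂ)) : Prop :=
  ∃ d : ℕ → ℝ → ℂ, (∀ j, ContDiff ℝ (⊤ : ℕ∞) (d j)) ∧ d 0 = 0 ∧ (∀ j, m + 1 < j → d j = 0) ∧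
    d (m+1) = a ∧ d m = b ∧
    ∀ f : ℝ → ℂ, ContDiff ℝ (⊤ : ℕ∞) f →
      T f = fun x => ∑ j ∈ Finset.range (m+1), d (j+1) x * iteratedDeriv j f x

lemma smooth_deriv {f : ℝ → ℂ} (hf : ContDiff ℝ (⊤ : ℕ∞) f) : ContDiff ℝ (⊤ : ℕ∞) (deriv f) :=
  (contDiff_infty_iff_deriv.mp hf).2

lemma smooth_diff {f : ℝ → ℂ} (hf : ContDiff ℝ (⊤ : ℕ∞) f) : Differentiable ℝ f :=
  (contDiff_infty_iff_deriv.mp hf).1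

lemma smooth_iter {f : ℝ → ℂ} (hf : ContDiff ℝ (⊤ : ℕ∞) f) (j : ℕ) :
    ContDiff ℝ (⊤ : ℕ∞) (iteratedDeriv j f) := by
  induction j with
  | zero => simpa using hf
  | succ j ih => rw [iteratedDeriv_succ]; exact smooth_deriv ih

lemma isDO_id : IsDO 0 1 0 id := by
  refine ⟨fun j => if j = 1 then 1 else 0, ?_, ?_, ?_, ?_, ?_, ?_⟩
  · intro j
    dsimp only
    split_ifs
    · exact contDiff_const
    · exact contDiff_const
  · simp
  · intro j hj
    have : j ≠ 1 := by omega
    simp [this]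
  · simp
  · simp
  · intro f hf
    funext x
    simp

lemma IsDO.mop {m : ℕ} {a b : ℝ → ℂ} {T} (h : IsDO m a b T) {Y : ℝ → ℂ}
    (hY : ContDiff ℝ (⊤ : ℕ∞) Y) : IsDO m (Y * a) (Y * b) (Mop Y ∘ T) := by
  obtain ⟨d, hd, h0, hz, ha, hb, hf⟩ := h
  refine ⟨fun j => Y * d j, fun j => hY.mul (hd j), by simp [h0], ?_, by simp [ha], by simp [hb], ?_⟩
  · intro j hj; simp [hz j hj]
  · intro f hf'
    funext x
    simp [Mop, hf f hf', Finset.mul_sum, mul_assoc]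

lemma IsDO.dop {m : ℕ} {a b : ℝ → ℂ} {T} (h : IsDO m a b T) {w : ℝ → ℂ}
    (hw : ContDiff ℝ (⊤ : ℕ∞) w) : IsDO (m+1) a (b + deriv a - w * a) (Dop w ∘ T) := by
  obtain ⟨d, hd, h0, hz, ha, hb, hf⟩ := h
  refine ⟨fun j => if j = 0 then 0 else d (j-1) + deriv (d j) - w * d j, ?_, by simp, ?_, ?_, ?_, ?_⟩
  · intro j
    dsimp only
    split_ifs
    · exact contDiff_const
    · exact ((hd _).add (smooth_deriv (hd _))).sub (hw.mul (hd _))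
  · intro j hj
    have h1 : j ≠ 0 := by omega
    have h2 : d (j-1) = 0 := hz _ (by omega)
    have h3 : d j = 0 := hz _ (by omega)
    have h4 : deriv (0 : ℝ → ℂ) = 0 := by funext x; exact deriv_const x 0
    simp [h1, h2, h3, h4]
  · have h3 : d (m+1+1) = 0 := hz _ (by omega)
    have h4 : deriv (0 : ℝ → ℂ) = 0 := by funext x; exact deriv_const x 0
    simp [h3, h4, ha]
  · simp [ha, hb]
  · intro f hf'
    funext x
    have hder : deriv (T f) x = ∑ j ∈ Finset.range (m+1),
        (deriv (d (j+1)) x * iteratedDeriv j f x + d (j+1) x * iteratedDeriv (j+1) f x) := by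
      rw [hf f hf']
      rw [deriv_fun_sum]
      · refine Finset.sum_congr rfl fun j _ => ?_
        rw [deriv_fun_mul (smooth_diff (hd _) x) (smooth_diff (smooth_iter hf' j) x),
          iteratedDeriv_succ]
      · intro j _
        exact (smooth_diff (hd _) x).mul (smooth_diff (smooth_iter hf' j) x)
    have hT : T f x = ∑ j ∈ Finset.range (m+1), d (j+1) x * iteratedDeriv j f x := by
      rw [hf f hf']
    have h3 : d (m+1+1) = 0 := hz _ (by omega)
    have h4 : deriv (0 : ℝ → ℂ) x = 0 := deriv_const x 0
    have e1 : ∑ j ∈ Finset.range (m+2), d j x * iteratedDeriv j f x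
        = ∑ j ∈ Finset.range (m+1), d (j+1) x * iteratedDeriv (j+1) f x := by
      rw [Finset.sum_range_succ']; simp [h0]
    have e2 : ∑ j ∈ Finset.range (m+2), (deriv (d (j+1)) x - w x * d (j+1) x) * iteratedDeriv j f x
        = ∑ j ∈ Finset.range (m+1), (deriv (d (j+1)) x - w x * d (j+1) x) * iteratedDeriv j f x := by
      rw [Finset.sum_range_succ]; simp [h3, h4]
    have e3 : (Dop w ∘ T) f x = deriv (T f) x - w x * T f x := by simp [Dop]
    rw [e3, hder, hT, Finset.mul_sum, Finset.sum_add_distrib, ← e1]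
    trans (∑ j ∈ Finset.range (m+2), d j x * iteratedDeriv j f x) +
      ∑ j ∈ Finset.range (m+2), (deriv (d (j+1)) x - w x * d (j+1) x) * iteratedDeriv j f x
    · rw [e2]
      simp only [sub_mul, Finset.sum_sub_distrib, mul_assoc]
      ring
    · rw [← Finset.sum_add_distrib]
      refine Finset.sum_congr rfl fun j _ => ?_
      simp
      ring

lemma isDO_foldr (c : ℕ → ℕ) (v : ℕ → ℝ → ℂ) (k : ℕ) (Y : ℝ → ℂ) {m : ℕ} {a b : ℝ → ℂ} {T}
    (h : IsDO m a b T) (l : List ℕ) (hl : ∀ p ∈ l, c p ≠ k)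
    (hv : ∀ p ∈ l, ContDiff ℝ (⊤ : ℕ∞) (v (c p))) :
    IsDO (m + l.length) a (b + (l.length : ℂ) • deriv a - (l.map fun p => v (c p)).sum * a)
      (l.foldr (fun p g => (if c p = k then Mop Y else Dop (v (c p))) ∘ g) T) := by
  induction l with
  | nil => simpa using h
  | cons q l ih =>
    have := (ih (fun p hp => hl p (by simp [hp])) (fun p hp => hv p (by simp [hp]))).dop
      (hv q (by simp))
    simp only [List.foldr_cons, if_neg (hl q (by simp)), List.length_cons, List.map_cons,
      List.sum_cons]
    rw [← add_assoc]
    convert this using 1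
    funext x
    simp
    ring

lemma cyc_mem {n i q : ℕ} (hi : i ∈ Finset.Icc 1 (2*n+1)) (hq : q < 2*n+1) :
    cyc n i q ∈ Finset.Icc 1 (2*n+1) := by
  simp only [Finset.mem_Icc, cyc] at *
  split_ifs <;> omega

lemma cyc_cyc {n i k : ℕ} (hi : i ∈ Finset.Icc 1 (2*n+1)) (hk : k ∈ Finset.Icc 1 (2*n+1)) :
    ∃ p, p < 2*n+1 ∧ cyc n i p = k ∧ (∀ q, q < 2*n+1 → cyc n i q = k → q = p) ∧
      p = (if k ≤ i then i - k else i + (2*n+1) - k) := by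
  refine ⟨_, ?_, ?_, ?_, rfl⟩ <;>
  simp only [Finset.mem_Icc, cyc] at *
  · split_ifs <;> omega
  · split_ifs <;> omega
  · intro q hq; split_ifs <;> omega

lemma sum_cyc {n i : ℕ} (hi : i ∈ Finset.Icc 1 (2*n+1)) (v : ℕ → ℝ → ℂ) :
    ((List.range (2*n+1)).map fun p => v (cyc n i p)).sum = ∑ k ∈ Finset.Icc 1 (2*n+1), v k := by
  have : ((List.range (2*n+1)).map fun p => v (cyc n i p)).sum
      = ∑ p ∈ Finset.range (2*n+1), v (cyc n i p) := by
    rfl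
  rw [this]
  refine Finset.sum_bij (fun p _ => cyc n i p) ?_ ?_ ?_ ?_
  · intro p hp; exact cyc_mem hi (by simpa using hp)
  · intro p hp q hq hpq
    obtain ⟨r, -, -, hr, -⟩ := cyc_cyc hi (cyc_mem hi (Finset.mem_range.mp hq))
    rw [hr p (Finset.mem_range.mp hp) hpq, hr q (Finset.mem_range.mp hq) rfl]
  · intro k hk
    obtain ⟨r, h1, h2, -, -⟩ := cyc_cyc hi hk
    exact ⟨r, Finset.mem_range.mpr h1, h2⟩
  · intros; rfl

lemma isDO_term {n i k : ℕ} (hi : i ∈ Finset.Icc 1 (2*n+1)) (hk : k ∈ Finset.Icc 1 (2*n+1))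
    (v X : ℕ → ℝ → ℂ)
    (hv : ∀ k ∈ Finset.Icc 1 (2*n+1), ContDiff ℝ (⊤ : ℕ∞) (v k))
    (hX : ∀ k ∈ Finset.Icc 1 (2*n+1), ContDiff ℝ (⊤ : ℕ∞) (X k))
    (hvsum : ∀ x, ∑ k ∈ Finset.Icc 1 (2*n+1), v k x = 0) :
    IsDO (2*n) (-(X k)) (fun x => -(v k x * X k x +
        (if k ≤ i then (i:ℂ) - k else (i:ℂ) + (2*(n:ℂ)+1) - k) * deriv (X k) x))
      ((List.range (2*n+1)).foldr
      (fun p g => (if cyc n i p = k then Mop (-(X k)) else Dop (v (cyc n i p))) ∘ g)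
      id) := by
  obtain ⟨p, hp, hpk, huniq, hpe⟩ := cyc_cyc hi hk
  obtain ⟨r, hr⟩ : ∃ r, 2*n = p + r := ⟨2*n - p, by omega⟩
  have hpc : (if k ≤ i then (i:ℂ) - k else (i:ℂ) + (2*(n:ℂ)+1) - k) = p := by
    simp only [Finset.mem_Icc] at hk
    rw [hpe]
    split_ifs with h
    · rw [Nat.cast_sub h]
    · rw [Nat.cast_sub (by omega)]; push_cast; ring
  set l2 : List ℕ := (List.range r).map (fun x => p + (x+1)) with hl2
  have hsplit : List.range (2*n+1) = List.range p ++ p :: l2 := by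
    rw [hr, add_assoc, List.range_add, List.range_succ_eq_map]
    simp [hl2, Function.comp_def]
  have hs := sum_cyc hi v
  have hmem1 : ∀ q ∈ List.range p, q < 2*n+1 ∧ cyc n i q ≠ k := by
    intro q hq
    have hq := List.mem_range.mp hq
    refine ⟨by omega, fun h => ?_⟩
    have := huniq q (by omega) h
    omega
  have hmem2 : ∀ q ∈ l2, q < 2*n+1 ∧ cyc n i q ≠ k := by
    intro q hq
    simp only [hl2, List.mem_map, List.mem_range] at hq
    obtain ⟨y, hy, rfl⟩ := hq
    refine ⟨by omega, fun h => ?_⟩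
    have := huniq _ (by omega) h
    omega
  have A := isDO_foldr (cyc n i) v k (-(X k)) isDO_id l2 (fun q hq => (hmem2 q hq).2)
    (fun q hq => hv _ (cyc_mem hi (hmem2 q hq).1))
  have hXn : ContDiff ℝ (⊤ : ℕ∞) (-(X k)) := (hX k hk).neg
  have B := A.mop hXn
  have C := isDO_foldr (cyc n i) v k (-(X k)) B (List.range p) (fun q hq => (hmem1 q hq).2)
    (fun q hq => hv _ (cyc_mem hi (hmem1 q hq).1))
  rw [hsplit, List.map_append, List.sum_append, List.map_cons, List.sum_cons, hpk] at hs
  rw [hsplit, List.foldr_append, List.foldr_cons, if_pos hpk]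
  have hlen : 0 + l2.length + (List.range p).length = 2*n := by simp [hl2]; omega
  rw [hlen] at C
  convert C using 1
  · simp
  · funext x
    have h1 := congrFun hs x
    rw [Finset.sum_apply, hvsum x] at h1
    have h4 : deriv (1 : ℝ → ℂ) x = 0 := deriv_const x 1
    have h5 : deriv (-(X k)) x = - deriv (X k) x := by
      exact deriv.neg
    simp only [Pi.add_apply] at h1
    rw [hpc]
    simp [h4, h5]
    linear_combination (-(X k x)) * h1

theorem stmt7 (n : ℕ) (hn : 2 ≤ n) (v X : ℕ → ℝ → ℂ)
    (hv : ∀ k ∈ Finset.Icc 1 (2*n+1), ContDiff ℝ (⊤ : ℕ∞) (v k))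
    (hX : ∀ k ∈ Finset.Icc 1 (2*n+1), ContDiff ℝ (⊤ : ℕ∞) (X k))
    (hvsum : ∀ x, ∑ k ∈ Finset.Icc 1 (2*n+1), v k x = 0)
    (hXsum : ∀ x, ∑ k ∈ Finset.Icc 1 (2*n+1), X k x = 0)
    (hXsym : ∀ k ∈ Finset.Icc 1 (2*n+1), ∀ x, X k x + X (2*n+2-k) x = 0)
    (i : ℕ) (hi : i ∈ Finset.Icc 1 (2*n+1)) :
    ∃ Z : ℕ → ℝ → ℂ, (∀ j ≤ 2*n-2, ContDiff ℝ (⊤ : ℕ∞) (Z j)) ∧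
      ∀ f : ℝ → ℂ, ContDiff ℝ (⊤ : ℕ∞) f →
        Zop n v X i f = fun x =>
          (-((∑ k ∈ Finset.Icc 1 (2*n+1), v k x * X k x)
              + (∑ k ∈ Finset.Icc 1 i, ((i : ℂ) - (k : ℂ)) * deriv (X k) x)
              + (∑ k ∈ Finset.Icc (i+1) (2*n+1),
                  ((i : ℂ) + (2*(n : ℂ)+1) - (k : ℂ)) * deriv (X k) x)))
            * iteratedDeriv (2*n-1) f x
          + ∑ j ∈ Finset.range (2*n-1), Z j x * iteratedDeriv j f x := by
  have key := fun k (hk : k ∈ Finset.Icc 1 (2*n+1)) => isDO_term hi hk v X hv hX hvsum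
  choose! d hd h0 hz ha hb hf using key
  refine ⟨fun j x => ∑ k ∈ Finset.Icc 1 (2*n+1), d k (j+1) x, ?_, ?_⟩
  · intro j _
    exact ContDiff.sum fun k hk => hd k hk (j+1)
  · intro f hf'
    funext x
    have e1 : Zop n v X i f x = ∑ j ∈ Finset.range (2*n+1),
        (∑ k ∈ Finset.Icc 1 (2*n+1), d k (j+1) x) * iteratedDeriv j f x := by
      simp only [Zop, Finset.sum_apply, Finset.sum_mul]
      rw [Finset.sum_comm]
      refine Finset.sum_congr rfl fun k hk => ?_
      rw [hf k hk f hf']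
    have e2 : ∑ k ∈ Finset.Icc 1 (2*n+1), d k (2*n+1) x = 0 := by
      rw [Finset.sum_congr rfl fun k hk => congrFun (ha k hk) x]
      simp [hXsum x]
    have hi' := Finset.mem_Icc.mp hi
    have hU : Finset.Icc 1 (2*n+1) = Finset.Icc 1 i ∪ Finset.Icc (i+1) (2*n+1) := by
      ext k; simp only [Finset.mem_union, Finset.mem_Icc]; omega
    have hdis : Disjoint (Finset.Icc 1 i) (Finset.Icc (i+1) (2*n+1)) := by
      rw [Finset.disjoint_left]; intro k; simp only [Finset.mem_Icc]; omega
    have e4 : ∑ k ∈ Finset.Icc 1 (2*n+1),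
        (if k ≤ i then (i:ℂ) - k else (i:ℂ) + (2*(n:ℂ)+1) - k) * deriv (X k) x
        = (∑ k ∈ Finset.Icc 1 i, ((i : ℂ) - (k : ℂ)) * deriv (X k) x)
          + (∑ k ∈ Finset.Icc (i+1) (2*n+1),
                  ((i : ℂ) + (2*(n : ℂ)+1) - (k : ℂ)) * deriv (X k) x) := by
      rw [hU, Finset.sum_union hdis]
      congr 1
      · refine Finset.sum_congr rfl fun k hk => ?_
        rw [if_pos (Finset.mem_Icc.mp hk).2]
      · refine Finset.sum_congr rfl fun k hk => ?_
        have := (Finset.mem_Icc.mp hk).1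
        rw [if_neg (by omega)]
    have e3 : ∑ k ∈ Finset.Icc 1 (2*n+1), d k (2*n) x =
        -((∑ k ∈ Finset.Icc 1 (2*n+1), v k x * X k x)
              + (∑ k ∈ Finset.Icc 1 i, ((i : ℂ) - (k : ℂ)) * deriv (X k) x)
              + (∑ k ∈ Finset.Icc (i+1) (2*n+1),
                  ((i : ℂ) + (2*(n : ℂ)+1) - (k : ℂ)) * deriv (X k) x)) := by
      rw [Finset.sum_congr rfl fun k hk => congrFun (hb k hk) x]
      rw [Finset.sum_neg_distrib, Finset.sum_add_distrib, e4, add_assoc]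
    rw [e1, Finset.sum_range_succ, e2, zero_mul, add_zero]
    obtain ⟨m, hm⟩ : ∃ m, 2*n = m + 1 := ⟨2*n-1, by omega⟩
    have hm' : 2*n-1 = m := by omega
    rw [← e3, hm']
    have : Finset.range (2*n) = Finset.range (m+1) := by rw [hm]
    rw [this, Finset.sum_range_succ, ← hm, add_comm]
end
end

section
/- Assume equation (E_i) holds for every i = 1,…,2n. Then X_i′ = 0 for all i = 2,…,2n, and X_1′ − 2·v_1·X_1 = Σ_{k=2}^{2n} v_k·X_k. -/
/-!
Context: fix `n ≥ 2`; `v_k, X_k : ℝ → ℂ` (`k = 1,…,2n+1`) are differentiable with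
`v_k + v_{2n+2−k} = 0` and `X_k + X_{2n+2−k} = 0`.  `(E_i)` is the equation recorded in
`EEq` below.

STATEMENT 8: if `(E_i)` holds for every `i = 1,…,2n`, then `X_i′ = 0` for `i = 2,…,2n`
and `X_1′ − 2 v_1 X_1 = Σ_{k=2}^{2n} v_k X_k`.
-/

noncomputable section

/-- Equation `(E_i)`: the vanishing of the coefficient of `∂^{2n−1}` in the image of the
tangent vector `X` under the tangent map of the `i`-th Miura map:
`Σ_{k=1}^{2n+1} v_k·X_k + Σ_{k=1}^{i} (i−k)·X_k′ + Σ_{k=i+1}^{2n+1} (i+2n+1−k)·X_k′ = 0`. -/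
def EEq (n : ℕ) (v X : ℕ → ℝ → ℂ) (i : ℕ) : Prop :=
  ∀ x : ℝ,
    (∑ k ∈ Finset.Icc 1 (2*n+1), v k x * X k x)
      + (∑ k ∈ Finset.Icc 1 i, ((i : ℂ) - (k : ℂ)) * deriv (X k) x)
      + (∑ k ∈ Finset.Icc (i+1) (2*n+1),
          ((i : ℂ) + (2*(n : ℂ)+1) - (k : ℂ)) * deriv (X k) x) = 0

theorem aux_split (f : ℕ → ℂ) (i N : ℕ) (h : i ≤ N) :
    (∑ k ∈ Finset.Icc 1 i, f k) + (∑ k ∈ Finset.Icc (i+1) N, f k) = ∑ k ∈ Finset.Icc 1 N, f k := by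
  simp only [← Finset.Ico_add_one_right_eq_Icc]
  exact Finset.sum_Ico_consecutive f (by omega) (by omega)

theorem aux_left (f : ℕ → ℂ) (i N : ℕ) (h : i ≤ N) :
    (∑ k ∈ Finset.Icc i N, f k) = f i + ∑ k ∈ Finset.Icc (i+1) N, f k := by
  simp only [← Finset.Ico_add_one_right_eq_Icc]
  exact Finset.sum_eq_sum_Ico_succ_bot (by omega) f

theorem aux_right (f : ℕ → ℂ) (i N : ℕ) (h : i ≤ N + 1) :
    (∑ k ∈ Finset.Icc i (N+1), f k) = (∑ k ∈ Finset.Icc i N, f k) + f (N+1) :=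
  Finset.sum_Icc_succ_top h f

theorem stmt8 (n : ℕ) (hn : 2 ≤ n) (v X : ℕ → ℝ → ℂ)
    (hv : ∀ k ∈ Finset.Icc 1 (2*n+1), Differentiable ℝ (v k))
    (hX : ∀ k ∈ Finset.Icc 1 (2*n+1), Differentiable ℝ (X k))
    (hvsym : ∀ k ∈ Finset.Icc 1 (2*n+1), ∀ x, v k x + v (2*n+2-k) x = 0)
    (hXsym : ∀ k ∈ Finset.Icc 1 (2*n+1), ∀ x, X k x + X (2*n+2-k) x = 0)
    (hE : ∀ i ∈ Finset.Icc 1 (2*n), EEq n v X i) :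
    (∀ i ∈ Finset.Icc 2 (2*n), ∀ x, deriv (X i) x = 0)
    ∧ ∀ x, deriv (X 1) x - 2 * v 1 x * X 1 x =
        ∑ k ∈ Finset.Icc 2 (2*n), v k x * X k x := by
  have hN : (2*(n:ℂ)+1) ≠ 0 := by exact_mod_cast Nat.succ_ne_zero (2*n)
  have hD : ∀ k ∈ Finset.Icc 1 (2*n+1), ∀ x, deriv (X (2*n+2-k)) x = - deriv (X k) x := by
    intro k hk x
    have : X (2*n+2-k) = fun y => - X k y := by
      funext y
      linear_combination hXsym k hk y
    rw [this, deriv.fun_neg]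
  have hsum : ∀ x, ∑ k ∈ Finset.Icc 1 (2*n+1), deriv (X k) x = 0 := by
    intro x
    have h1 : ∑ k ∈ Finset.Icc 1 (2*n+1), deriv (X k) x
        = ∑ k ∈ Finset.Icc 1 (2*n+1), - deriv (X k) x := by
      refine Finset.sum_nbij' (fun k => 2*n+2-k) (fun k => 2*n+2-k) ?_ ?_ ?_ ?_ ?_
      · intro k hk; simp only [Finset.mem_Icc] at *; omega
      · intro k hk; simp only [Finset.mem_Icc] at *; omega
      · intro k hk; simp only [Finset.mem_Icc] at *; omega
      · intro k hk; simp only [Finset.mem_Icc] at *; omega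
      · intro k hk; rw [hD k hk, neg_neg]
    rw [Finset.sum_neg_distrib] at h1
    linear_combination h1 / 2
  have hF : ∀ i ∈ Finset.Icc 1 (2*n), ∀ x,
      (∑ k ∈ Finset.Icc 1 (2*n+1), v k x * X k x)
       - (∑ k ∈ Finset.Icc 1 (2*n+1), (k:ℂ) * deriv (X k) x)
       + (2*(n:ℂ)+1) * (∑ k ∈ Finset.Icc (i+1) (2*n+1), deriv (X k) x) = 0 := by
    intro i hi x
    have e := hE i hi x
    have hi' : i ≤ 2*n+1 := by simp only [Finset.mem_Icc] at hi; omega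
    have s1 := aux_split (fun k => ((i : ℂ) - (k : ℂ)) * deriv (X k) x) i (2*n+1) hi'
    have s2 : ∑ k ∈ Finset.Icc (i+1) (2*n+1),
          ((i : ℂ) + (2*(n : ℂ)+1) - (k : ℂ)) * deriv (X k) x
        = (∑ k ∈ Finset.Icc (i+1) (2*n+1), ((i : ℂ) - (k : ℂ)) * deriv (X k) x)
          + (2*(n:ℂ)+1) * (∑ k ∈ Finset.Icc (i+1) (2*n+1), deriv (X k) x) := by
      rw [Finset.mul_sum, ← Finset.sum_add_distrib]
      exact Finset.sum_congr rfl fun k _ => by ring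
    have s3 : ∑ k ∈ Finset.Icc 1 (2*n+1), ((i : ℂ) - (k : ℂ)) * deriv (X k) x
        = (i:ℂ) * (∑ k ∈ Finset.Icc 1 (2*n+1), deriv (X k) x)
          - ∑ k ∈ Finset.Icc 1 (2*n+1), (k:ℂ) * deriv (X k) x := by
      rw [Finset.mul_sum, ← Finset.sum_sub_distrib]
      exact Finset.sum_congr rfl fun k _ => by ring
    rw [hsum x] at s3
    linear_combination e - s1 - s2 - s3
  have hzero : ∀ i ∈ Finset.Icc 2 (2*n), ∀ x, deriv (X i) x = 0 := by
    intro i hi x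
    simp only [Finset.mem_Icc] at hi
    obtain ⟨j, rfl⟩ : ∃ j, i = j + 1 := ⟨i - 1, by omega⟩
    have a := hF j (by simp only [Finset.mem_Icc]; omega) x
    have b := hF (j+1) (by simp only [Finset.mem_Icc]; omega) x
    rw [aux_left (fun k => deriv (X k) x) (j+1) (2*n+1) (by omega)] at a
    have : (2*(n:ℂ)+1) * deriv (X (j+1)) x = 0 := by linear_combination a - b
    exact (mul_eq_zero.mp this).resolve_left hN
  refine ⟨hzero, fun x => ?_⟩
  have m1 : 1 ∈ Finset.Icc 1 (2*n+1) := by simp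
  have e1 : 2*n+2-1 = 2*n+1 := by omega
  have dl := hD 1 m1 x
  have vl := hvsym 1 m1 x
  have xl := hXsym 1 m1 x
  rw [e1] at dl vl xl
  have f := hF 1 (by simp only [Finset.mem_Icc]; omega) x
  have key : ∀ g : ℕ → ℂ, ∑ k ∈ Finset.Icc 1 (2*n+1), g k
      = g 1 + ((∑ k ∈ Finset.Icc 2 (2*n), g k) + g (2*n+1)) := by
    intro g
    rw [aux_left g 1 (2*n+1) (by omega), aux_right g (1+1) (2*n) (by omega)]
  rw [key, key, aux_right _ (1+1) (2*n) (by omega)] at f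
  have z1 : ∑ k ∈ Finset.Icc 2 (2*n), (k:ℂ) * deriv (X k) x = 0 :=
    Finset.sum_eq_zero fun k hk => by rw [hzero k hk x, mul_zero]
  have z2 : ∑ k ∈ Finset.Icc (1+1) (2*n), deriv (X k) x = 0 :=
    Finset.sum_eq_zero fun k hk => hzero k hk x
  rw [z1, z2, dl, eq_neg_of_add_eq_zero_right vl, eq_neg_of_add_eq_zero_right xl] at f
  push_cast at f
  linear_combination -f
end
end

section
/- Let j ∈ {1,…,n−1} and assume equation (E_i) holds for every i ∈ {1,…,2n+1} with i ∉ {j, 2n+1−j}. Then X_j′ + v_j·X_j + v_{j+1}·X_{j+1} = −Σ_{k=1, k∉{j,j+1}}^{n} v_k·X_k, X_j′ + X_{j+1}′ = 0, X_{2n+1−j}′ + X_{2n+2−j}′ = 0, and X_i′ = 0 for every i ∉ {j, j+1, 2n+1−j, 2n+2−j}. -/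
/-!
Context: fix `n ≥ 2`; `v_k, X_k : ℝ → ℂ` (`k = 1,…,2n+1`) are differentiable with
`v_k + v_{2n+2−k} = 0` and `X_k + X_{2n+2−k} = 0`.  `(E_i)` is the equation recorded in
`EEq` below.

STATEMENT 9: let `j ∈ {1,…,n−1}` and assume `(E_i)` for every `i ∈ {1,…,2n+1}` with
`i ∉ {j, 2n+1−j}`.  Then `X_j′ + v_j X_j + v_{j+1} X_{j+1} = −Σ_{k=1,k∉{j,j+1}}^{n} v_k X_k`,
`X_j′ + X_{j+1}′ = 0`, `X_{2n+1−j}′ + X_{2n+2−j}′ = 0`, and `X_i′ = 0` for every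
`i ∉ {j, j+1, 2n+1−j, 2n+2−j}`.
-/

noncomputable section

theorem aux_core (n j : ℕ) (hn : 2 ≤ n) (hj1 : 1 ≤ j) (hj2 : j ≤ n - 1) (f d : ℕ → ℂ)
    (hf : ∀ k ∈ Finset.Icc 1 (2*n+1), f (2*n+2-k) = f k) (hf0 : f (n+1) = 0)
    (hd : ∀ k ∈ Finset.Icc 1 (2*n+1), d (2*n+2-k) = - d k)
    (hE : ∀ i ∈ Finset.Icc 1 (2*n+1), i ≠ j → i ≠ 2*n+1-j →
      (∑ k ∈ Finset.Icc 1 (2*n+1), f k)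
      + (∑ k ∈ Finset.Icc 1 i, ((i : ℂ) - (k : ℂ)) * d k)
      + (∑ k ∈ Finset.Icc (i+1) (2*n+1),
          ((i : ℂ) + (2*(n : ℂ)+1) - (k : ℂ)) * d k) = 0) :
    (d j + f j + f (j+1) =
        -∑ k ∈ (Finset.Icc 1 n).filter (fun k => k ≠ j ∧ k ≠ j+1), f k)
    ∧ (d j + d (j+1) = 0)
    ∧ (d (2*n+1-j) + d (2*n+2-j) = 0)
    ∧ (∀ i ∈ Finset.Icc 1 (2*n+1),
        i ≠ j → i ≠ j+1 → i ≠ 2*n+1-j → i ≠ 2*n+2-j → d i = 0) := by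
  have hIcc : ∀ a b : ℕ, Finset.Icc (a+1) b = Finset.Ioc a b := by
    intro a b; ext k; simp only [Finset.mem_Icc, Finset.mem_Ioc]; omega
  have hsplit : ∀ (g : ℕ → ℂ) (i : ℕ), i ≤ 2*n+1 →
      ∑ k ∈ Finset.Icc 1 i, g k + ∑ k ∈ Finset.Icc (i+1) (2*n+1), g k
        = ∑ k ∈ Finset.Icc 1 (2*n+1), g k := by
    intro g i hi
    rw [hIcc 0, hIcc 0, hIcc i]
    exact Finset.sum_Ioc_consecutive g (Nat.zero_le _) hi
  have hPN : ∑ k ∈ Finset.Icc 1 (2*n+1), d k = 0 := by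
    have h : ∑ k ∈ Finset.Icc 1 (2*n+1), d k = ∑ k ∈ Finset.Icc 1 (2*n+1), - d k := by
      refine Finset.sum_nbij' (fun k => 2*n+2-k) (fun k => 2*n+2-k) ?_ ?_ ?_ ?_ ?_
      · intro k hk; simp only [Finset.mem_Icc] at *; omega
      · intro k hk; simp only [Finset.mem_Icc] at *; omega
      · intro k hk; simp only [Finset.mem_Icc] at *; omega
      · intro k hk; simp only [Finset.mem_Icc] at *; omega
      · intro k hk; simp [hd k hk]
    rw [Finset.sum_neg_distrib] at h
    linear_combination h / 2
  have hE2 : ∀ i ∈ Finset.Icc 1 (2*n+1), i ≠ j → i ≠ 2*n+1-j →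
      (∑ k ∈ Finset.Icc 1 (2*n+1), f k) - (∑ k ∈ Finset.Icc 1 (2*n+1), (k:ℂ) * d k)
        = (2*(n:ℂ)+1) * ∑ k ∈ Finset.Icc 1 i, d k := by
    intro i hi h1 h2
    have h := hE i hi h1 h2
    have hi' : i ≤ 2*n+1 := (Finset.mem_Icc.1 hi).2
    have e1 : ∑ k ∈ Finset.Icc 1 i, ((i : ℂ) - (k : ℂ)) * d k
        = i * ∑ k ∈ Finset.Icc 1 i, d k - ∑ k ∈ Finset.Icc 1 i, (k:ℂ) * d k := by
      rw [Finset.mul_sum, ← Finset.sum_sub_distrib]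
      exact Finset.sum_congr rfl fun k _ => by ring
    have e2 : ∑ k ∈ Finset.Icc (i+1) (2*n+1), ((i : ℂ) + (2*(n : ℂ)+1) - (k : ℂ)) * d k
        = ((i : ℂ) + (2*(n : ℂ)+1)) * ∑ k ∈ Finset.Icc (i+1) (2*n+1), d k
          - ∑ k ∈ Finset.Icc (i+1) (2*n+1), (k:ℂ) * d k := by
      rw [Finset.mul_sum, ← Finset.sum_sub_distrib]
      exact Finset.sum_congr rfl fun k _ => by ring
    rw [e1, e2] at h
    have s1 := hsplit d i hi'
    have s2 := hsplit (fun k => (k:ℂ) * d k) i hi'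
    rw [hPN] at s1
    linear_combination h + s2 - ((i : ℂ) + (2*(n : ℂ)+1)) * s1
  have hSW := hE2 (2*n+1) (by simp) (by omega) (by omega)
  rw [hPN, mul_zero] at hSW
  have hN : (2*(n:ℂ)+1) ≠ 0 := by exact_mod_cast (by omega : 2*n+1 ≠ 0)
  have hP : ∀ i, i ≤ 2*n+1 → i ≠ j → i ≠ 2*n+1-j → ∑ k ∈ Finset.Icc 1 i, d k = 0 := by
    intro i hi h1 h2
    rcases Nat.eq_zero_or_pos i with rfl | h0
    · simp
    · have h := hE2 i (Finset.mem_Icc.2 ⟨h0, hi⟩) h1 h2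
      rw [hSW] at h
      exact (mul_eq_zero.1 h.symm).resolve_left hN
  have hstep : ∀ i, ∑ k ∈ Finset.Icc 1 (i+1), d k = ∑ k ∈ Finset.Icc 1 i, d k + d (i+1) := by
    intro i; exact Finset.sum_Icc_succ_top (by omega) _
  have hz : ∀ i ∈ Finset.Icc 1 (2*n+1),
        i ≠ j → i ≠ j+1 → i ≠ 2*n+1-j → i ≠ 2*n+2-j → d i = 0 := by
    intro i hi h1 h2 h3 h4
    obtain ⟨ha, hb⟩ := Finset.mem_Icc.1 hi
    obtain ⟨m, rfl⟩ : ∃ m, i = m+1 := ⟨i-1, by omega⟩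
    have h := hstep m
    rw [hP (m+1) hb h1 h3, hP m (by omega) (by omega) (by omega)] at h
    simpa using h.symm
  have h2 : d j + d (j+1) = 0 := by
    obtain ⟨m, rfl⟩ : ∃ m, j = m+1 := ⟨j-1, by omega⟩
    have a := hstep m
    have b := hstep (m+1)
    rw [hP m (by omega) (by omega) (by omega)] at a
    rw [hP (m+1+1) (by omega) (by omega) (by omega)] at b
    linear_combination -a - b
  have r1 := hd j (Finset.mem_Icc.2 (by omega))
  have r2 := hd (j+1) (Finset.mem_Icc.2 (by omega))
  rw [show 2*n+2-(j+1) = 2*n+1-j by omega] at r2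
  refine ⟨?_, h2, by rw [r1, r2]; linear_combination -h2, hz⟩
  have hW : ∑ k ∈ Finset.Icc 1 (2*n+1), (k:ℂ) * d k = -2 * d j := by
    have hsub : ({j, j+1, 2*n+1-j, 2*n+2-j} : Finset ℕ) ⊆ Finset.Icc 1 (2*n+1) := by
      intro k hk
      simp only [Finset.mem_insert, Finset.mem_singleton, Finset.mem_Icc] at *; omega
    rw [← Finset.sum_subset hsub]
    · rw [Finset.sum_insert, Finset.sum_insert, Finset.sum_insert, Finset.sum_singleton, r1, r2,
        Nat.cast_sub (by omega), Nat.cast_sub (by omega)]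
      · push_cast
        linear_combination (2*(j:ℂ) - 2*n) * h2
      all_goals simp only [Finset.mem_insert, Finset.mem_singleton]; omega
    · intro k hk hk'
      simp only [Finset.mem_insert, Finset.mem_singleton, not_or] at hk'
      rw [hz k hk hk'.1 hk'.2.1 hk'.2.2.1 hk'.2.2.2, mul_zero]
  have hS : ∑ k ∈ Finset.Icc 1 (2*n+1), f k = 2 * ∑ k ∈ Finset.Icc 1 n, f k := by
    have a := hsplit f (n+1) (by omega)
    have b : ∑ k ∈ Finset.Icc 1 (n+1), f k = ∑ k ∈ Finset.Icc 1 n, f k + f (n+1) :=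
      Finset.sum_Icc_succ_top (by omega) _
    have c : ∑ k ∈ Finset.Icc (n+1+1) (2*n+1), f k = ∑ k ∈ Finset.Icc 1 n, f k := by
      refine Finset.sum_nbij' (fun k => 2*n+2-k) (fun k => 2*n+2-k) ?_ ?_ ?_ ?_ ?_
      · intro k hk; simp only [Finset.mem_Icc] at *; omega
      · intro k hk; simp only [Finset.mem_Icc] at *; omega
      · intro k hk; simp only [Finset.mem_Icc] at *; omega
      · intro k hk; simp only [Finset.mem_Icc] at *; omega
      · intro k hk
        refine (hf k ?_).symm
        simp only [Finset.mem_Icc] at *; omega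
    linear_combination -a + b + c + hf0
  have hF := Finset.sum_filter_add_sum_filter_not (Finset.Icc 1 n)
    (fun k => k ≠ j ∧ k ≠ j+1) f
  have hset : (Finset.Icc 1 n).filter (fun k => ¬ (k ≠ j ∧ k ≠ j+1)) = {j, j+1} := by
    ext k
    simp only [Finset.mem_filter, Finset.mem_Icc, Finset.mem_insert, Finset.mem_singleton]
    omega
  rw [hset, Finset.sum_pair (by omega)] at hF
  linear_combination hF + hSW / 2 - hS / 2 + hW / 2

theorem stmt9 (n : ℕ) (hn : 2 ≤ n) (v X : ℕ → ℝ → ℂ)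
    (hv : ∀ k ∈ Finset.Icc 1 (2*n+1), Differentiable ℝ (v k))
    (hX : ∀ k ∈ Finset.Icc 1 (2*n+1), Differentiable ℝ (X k))
    (hvsym : ∀ k ∈ Finset.Icc 1 (2*n+1), ∀ x, v k x + v (2*n+2-k) x = 0)
    (hXsym : ∀ k ∈ Finset.Icc 1 (2*n+1), ∀ x, X k x + X (2*n+2-k) x = 0)
    (j : ℕ) (hj1 : 1 ≤ j) (hj2 : j ≤ n - 1)
    (hE : ∀ i ∈ Finset.Icc 1 (2*n+1), i ≠ j → i ≠ 2*n+1-j → EEq n v X i) :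
    (∀ x, deriv (X j) x + v j x * X j x + v (j+1) x * X (j+1) x =
        -∑ k ∈ (Finset.Icc 1 n).filter (fun k => k ≠ j ∧ k ≠ j+1), v k x * X k x)
    ∧ (∀ x, deriv (X j) x + deriv (X (j+1)) x = 0)
    ∧ (∀ x, deriv (X (2*n+1-j)) x + deriv (X (2*n+2-j)) x = 0)
    ∧ (∀ i ∈ Finset.Icc 1 (2*n+1),
        i ≠ j → i ≠ j+1 → i ≠ 2*n+1-j → i ≠ 2*n+2-j → ∀ x, deriv (X i) x = 0) := by
  have hf : ∀ x, ∀ k ∈ Finset.Icc 1 (2*n+1),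
      v (2*n+2-k) x * X (2*n+2-k) x = v k x * X k x := by
    intro x k hk
    have a := hvsym k hk x
    have b := hXsym k hk x
    linear_combination X (2*n+2-k) x * a - v k x * b
  have hf0 : ∀ x, v (n+1) x * X (n+1) x = 0 := by
    intro x
    have a := hvsym (n+1) (Finset.mem_Icc.2 (by omega)) x
    rw [show 2*n+2-(n+1) = n+1 by omega] at a
    linear_combination X (n+1) x * a / 2
  have hd : ∀ x, ∀ k ∈ Finset.Icc 1 (2*n+1),
      deriv (X (2*n+2-k)) x = - deriv (X k) x := by
    intro x k hk
    have e : X (2*n+2-k) = fun y => - X k y := by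
      funext y
      linear_combination hXsym k hk y
    rw [e, deriv.fun_neg]
  have key := fun x => aux_core n j hn hj1 hj2 (fun k => v k x * X k x)
    (fun k => deriv (X k) x) (hf x) (hf0 x) (hd x)
    (fun i hi h1 h2 => hE i hi h1 h2 x)
  exact ⟨fun x => (key x).1, fun x => (key x).2.1, fun x => (key x).2.2.1,
    fun i hi h1 h2 h3 h4 x => (key x).2.2.2 i hi h1 h2 h3 h4⟩
end
end

section
/- Let k = (k_0,…,k_n) ∈ ℕ^{n+1} and let u_i^{(j)} ∈ ℂ (0 ≤ j ≤ n, 1 ≤ i ≤ k_j) be such that the tuple y = (y_0,…,y_n) with y_j(x) = Π_{i=1}^{k_j}(x − u_i^{(j)}) is generic. Then u is a critical point of the master function Φ(u;k) of type A_{2n}^{(2)} if and only if the tuple y is fertile. -/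
/-!
Context: fix `n ≥ 2`.  `Wr`, `GenericT`, `FertileT` are as in the paper (type `A_{2n}^{(2)}`).
`IsCritical n k u` records the critical point equations of the master function
`Φ(u;k)` of type `A_{2n}^{(2)}`.

STATEMENT 11: let `k = (k_0,…,k_n) ∈ ℕ^{n+1}` and `u_i^{(j)} ∈ ℂ` be such that the tuple
`y` with `y_j(x) = Π_{i=1}^{k_j}(x − u_i^{(j)})` is generic.  Then `u` is a critical point
of `Φ(u;k)` iff `y` is fertile.
-/

noncomputable section

/-- The Wronskian `Wr(f,g) = f·g′ − f′·g`. -/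
def Wr (f g : Polynomial ℂ) : Polynomial ℂ :=
  f * Polynomial.derivative g - Polynomial.derivative f * g

/-- A tuple `(y_0,…,y_n)` of complex polynomials is generic if every `y_i` is a nonzero
polynomial without multiple roots and `y_i`, `y_{i+1}` have no common roots. -/
def GenericT (n : ℕ) (y : ℕ → Polynomial ℂ) : Prop :=
  (∀ i ≤ n, y i ≠ 0)
  ∧ (∀ i ≤ n, ∀ z : ℂ, (y i).rootMultiplicity z ≤ 1)
  ∧ (∀ i < n, ∀ z : ℂ, ¬((y i).IsRoot z ∧ (y (i+1)).IsRoot z))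

/-- A tuple `(y_0,…,y_n)` is fertile if there are polynomials `ỹ_0,…,ỹ_n` with
`Wr(ỹ_0,y_0) = y_1²`, `Wr(ỹ_i,y_i) = y_{i−1}·y_{i+1}` for `i = 1,…,n−2`,
`Wr(ỹ_{n−1},y_{n−1}) = y_{n−2}·y_n²`, and `Wr(ỹ_n,y_n) = y_{n−1}`. -/
def FertileT (n : ℕ) (y : ℕ → Polynomial ℂ) : Prop :=
  ∃ ty : ℕ → Polynomial ℂ,
    Wr (ty 0) (y 0) = (y 1) ^ 2
    ∧ (∀ i, 1 ≤ i → i ≤ n - 2 → Wr (ty i) (y i) = y (i-1) * y (i+1))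
    ∧ Wr (ty (n-1)) (y (n-1)) = y (n-2) * (y n) ^ 2
    ∧ Wr (ty n) (y n) = y (n-1)

/-- The critical point equations of the master function `Φ(u;k)` of type `A_{2n}^{(2)}`. -/
def IsCritical (n : ℕ) (k : ℕ → ℕ) (u : ℕ → ℕ → ℂ) : Prop :=
  (∀ j ∈ Finset.Icc 1 (k 0),
      (∑ s ∈ (Finset.Icc 1 (k 0)).erase j, 2 / (u 0 j - u 0 s))
        - (∑ l ∈ Finset.Icc 1 (k 1), 2 / (u 0 j - u 1 l)) = 0)
  ∧ (∀ i, 1 ≤ i → i ≤ n - 2 → ∀ j ∈ Finset.Icc 1 (k i),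
      -(∑ l ∈ Finset.Icc 1 (k (i-1)), 2 / (u i j - u (i-1) l))
        - (∑ l ∈ Finset.Icc 1 (k (i+1)), 2 / (u i j - u (i+1) l))
        + (∑ s ∈ (Finset.Icc 1 (k i)).erase j, 4 / (u i j - u i s)) = 0)
  ∧ (∀ j ∈ Finset.Icc 1 (k (n-1)),
      -(∑ l ∈ Finset.Icc 1 (k (n-2)), 2 / (u (n-1) j - u (n-2) l))
        - (∑ l ∈ Finset.Icc 1 (k n), 4 / (u (n-1) j - u n l))
        + (∑ s ∈ (Finset.Icc 1 (k (n-1))).erase j, 4 / (u (n-1) j - u (n-1) s)) = 0)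
  ∧ (∀ j ∈ Finset.Icc 1 (k n),
      -(∑ l ∈ Finset.Icc 1 (k (n-1)), 4 / (u n j - u (n-1) l))
        + (∑ s ∈ (Finset.Icc 1 (k n)).erase j, 8 / (u n j - u n s)) = 0)

open Polynomial in
lemma exists_antideriv (p : ℂ[X]) : ∃ q : ℂ[X], derivative q = p := by
  induction p using Polynomial.induction_on' with
  | add p q hp hq =>
    obtain ⟨a, rfl⟩ := hp
    obtain ⟨b, rfl⟩ := hq
    exact ⟨a + b, by simp⟩
  | monomial n a =>
    refine ⟨monomial (n+1) (a / (n+1)), ?_⟩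
    have h : (n : ℂ) + 1 ≠ 0 := by exact_mod_cast Nat.succ_ne_zero n
    rw [derivative_monomial]
    simp [h]

open Polynomial in
lemma wr_of_dvd (y g : ℂ[X]) (hc : IsCoprime y (derivative y))
    (hd : y ∣ derivative y * derivative g - derivative (derivative y) * g) :
    ∃ t, Wr t y = g := by
  obtain ⟨a, b, hab⟩ := hc
  obtain ⟨c, hcc⟩ := hd
  have hc' : IsCoprime y (derivative y ^ 2) := IsCoprime.pow_right ⟨a, b, hab⟩
  set t := b * g with ht
  obtain ⟨h, hh⟩ : ∃ h, h = -(a * g + derivative t) := ⟨_, rfl⟩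
  have hW : t * derivative y - derivative t * y = g + y * h := by
    rw [hh]; linear_combination g * hab
  have hW' := congrArg derivative hW
  simp only [derivative_sub, derivative_mul, derivative_add] at hW'
  have hy : y ∣ derivative y ^ 2 * h := by
    refine ⟨-c - derivative y * derivative h - derivative y * derivative (derivative t)
      + derivative (derivative y) * (h + derivative t), ?_⟩
    linear_combination (-derivative y) * hW' - hcc + derivative (derivative y) * hW
  obtain ⟨h1, rfl⟩ := hc'.dvd_of_dvd_mul_left hy
  obtain ⟨H, rfl⟩ := exists_antideriv h1
  refine ⟨t + y * H, ?_⟩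
  simp only [Wr, derivative_add, derivative_mul]
  linear_combination hW

open Polynomial in
lemma eval_deriv_prod (S : Finset ℕ) (v : ℕ → ℂ) (z : ℂ) (hz : ∀ i ∈ S, z ≠ v i) :
    (derivative (∏ i ∈ S, (X - C (v i)))).eval z
      = (∏ i ∈ S, (X - C (v i))).eval z * ∑ i ∈ S, 1 / (z - v i) := by
  induction S using Finset.induction_on with
  | empty => simp
  | insert a S ha ih =>
    have h1 : z - v a ≠ 0 := sub_ne_zero.2 (hz a (by simp))
    rw [Finset.prod_insert ha, Finset.sum_insert ha, derivative_mul]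
    simp only [derivative_sub, derivative_X, derivative_C, eval_add, eval_mul, eval_sub, eval_X,
      eval_C, sub_zero, eval_one]
    rw [ih (fun i hi => hz i (by simp [hi]))]
    field_simp

open Polynomial in
lemma key (S : Finset ℕ) (v : ℕ → ℂ) (y g : ℂ[X]) (hy : y = ∏ i ∈ S, (X - C (v i)))
    (hm : ∀ z, y.rootMultiplicity z ≤ 1) (hg : ∀ z, y.IsRoot z → ¬ g.IsRoot z) :
    (∃ t, Wr t y = g) ↔
      ∀ j ∈ S, 2 * ∑ s ∈ S.erase j, 1 / (v j - v s)
        = (derivative g).eval (v j) / g.eval (v j) := by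
  have hy0 : y ≠ 0 := by
    rw [hy]; exact Finset.prod_ne_zero_iff.2 fun i _ => X_sub_C_ne_zero _
  have hinj : ∀ i ∈ S, ∀ j ∈ S, i ≠ j → v i ≠ v j := by
    intro i hi j hj hij he
    have : (X - C (v i)) ^ 2 ∣ y := by
      rw [hy, ← Finset.mul_prod_erase S _ hi,
        ← Finset.mul_prod_erase (S.erase i) _ (Finset.mem_erase.2 ⟨hij.symm, hj⟩), ← he, ← mul_assoc, sq]
      exact dvd_mul_right _ _
    have := (le_rootMultiplicity_iff hy0).2 this
    have := hm (v i)
    omega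
  have hroot : ∀ j ∈ S, y.IsRoot (v j) := by
    intro j hj
    rw [hy, ← Finset.mul_prod_erase S _ hj]; simp
  have hev : ∀ j ∈ S, (derivative y).eval (v j) ≠ 0 ∧
      (derivative (derivative y)).eval (v j)
        = (derivative y).eval (v j) * (2 * ∑ s ∈ S.erase j, 1 / (v j - v s)) := by
    intro j hj
    have hz : ∀ i ∈ S.erase j, v j ≠ v i := fun i hi =>
      hinj j hj i (Finset.mem_of_mem_erase hi) (Finset.ne_of_mem_erase hi).symm
    have h := eval_deriv_prod (S.erase j) v (v j) hz
    have hq : (∏ i ∈ S.erase j, (X - C (v i))).eval (v j) ≠ 0 := by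
      rw [eval_prod]
      refine Finset.prod_ne_zero_iff.2 fun i hi => ?_
      simpa [sub_eq_zero] using hz i hi
    rw [hy, ← Finset.mul_prod_erase S _ hj]
    generalize (∏ i ∈ S.erase j, (X - C (v i))) = q at *
    simp [derivative_mul, hq, h]
    ring
  have hcond : ∀ j ∈ S, ((2 * ∑ s ∈ S.erase j, 1 / (v j - v s)
        = (derivative g).eval (v j) / g.eval (v j)) ↔
      (derivative y * derivative g - derivative (derivative y) * g).eval (v j) = 0) := by
    intro j hj
    obtain ⟨h1, h2⟩ := hev j hj
    have h3 : g.eval (v j) ≠ 0 := hg _ (hroot j hj)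
    rw [eval_sub, eval_mul, eval_mul, h2, eq_div_iff h3,
      mul_assoc (eval (v j) (derivative y)), ← mul_sub, mul_eq_zero,
      or_iff_right h1, sub_eq_zero, eq_comm]
  have hcopS : ∀ p : ℂ[X], (∀ j ∈ S, p.eval (v j) = 0) → y ∣ p := by
    intro p hp
    rw [hy]
    refine Finset.prod_dvd_of_coprime ?_ fun i hi => dvd_iff_isRoot.2 (hp i hi)
    intro i hi j hj hij
    exact isCoprime_X_sub_C_of_isUnit_sub (sub_ne_zero.2 (hinj i hi j hj hij)).isUnit
  have hcop : IsCoprime y (derivative y) := by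
    conv_lhs => rw [hy]
    refine IsCoprime.prod_left fun i hi => ?_
    refine ((irreducible_X_sub_C (v i)).coprime_iff_not_dvd).2 fun hd => ?_
    exact (hev i hi).1 (dvd_iff_isRoot.1 hd)
  constructor
  · rintro ⟨t, rfl⟩ j hj
    rw [hcond j hj]
    have := hroot j hj
    simp only [IsRoot] at this
    simp [Wr, derivative_mul, this]
    ring
  · intro h
    exact wr_of_dvd y g hcop (hcopS _ fun j hj => (hcond j hj).1 (h j hj))

open Polynomial in
lemma logd_prod (S : Finset ℕ) (v : ℕ → ℂ) (y : ℂ[X]) (hy : y = ∏ i ∈ S, (X - C (v i)))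
    (z : ℂ) (hz : ¬ y.IsRoot z) :
    y.eval z ≠ 0 ∧ (derivative y).eval z = y.eval z * ∑ i ∈ S, 1 / (z - v i) := by
  refine ⟨hz, ?_⟩
  rw [hy]
  refine eval_deriv_prod S v z fun i hi he => hz ?_
  rw [hy, ← Finset.mul_prod_erase S _ hi, he]; simp

lemma sum_const_div (S : Finset ℕ) (c : ℂ) (f : ℕ → ℂ) :
    ∑ i ∈ S, c / f i = c * ∑ i ∈ S, 1 / f i := by
  rw [Finset.mul_sum]; exact Finset.sum_congr rfl fun i _ => by ring

theorem stmt11 (n : ℕ) (hn : 2 ≤ n) (k : ℕ → ℕ) (u : ℕ → ℕ → ℂ)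
    (y : ℕ → Polynomial ℂ)
    (hy : ∀ j ≤ n, y j = ∏ i ∈ Finset.Icc 1 (k j), (Polynomial.X - Polynomial.C (u j i)))
    (hgen : GenericT n y) :
    IsCritical n k u ↔ FertileT n y := by
  obtain ⟨-, hm, hr⟩ := hgen
  have hroot : ∀ i ≤ n, ∀ j ∈ Finset.Icc 1 (k i), (y i).IsRoot (u i j) := by
    intro i hi j hj
    rw [hy i hi, ← Finset.mul_prod_erase _ _ hj]; simp
  have hup : ∀ i < n, ∀ z, (y i).IsRoot z → ¬ (y (i+1)).IsRoot z :=
    fun i hi z h1 h2 => hr i hi z ⟨h1, h2⟩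
  have hdn : ∀ i < n, ∀ z, (y (i+1)).IsRoot z → ¬ (y i).IsRoot z :=
    fun i hi z h1 h2 => hr i hi z ⟨h2, h1⟩
  obtain ⟨m, rfl⟩ : ∃ m, n = m + 2 := ⟨n - 2, by omega⟩
  have e1 : m + 2 - 1 = m + 1 := rfl
  have e2 : m + 2 - 2 = m := rfl
  have h0 : (∃ t, Wr t (y 0) = (y 1) ^ 2) ↔ _ :=
    key _ (u 0) (y 0) (y 1 ^ 2) (hy 0 (by omega)) (hm 0 (by omega))
      (fun z hz => by simpa [Polynomial.IsRoot] using hup 0 (by omega) z hz)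
  have hi : ∀ i, 1 ≤ i → i ≤ m → ((∃ t, Wr t (y i) = y (i-1) * y (i+1)) ↔ _) := fun i h1 h2 =>
    key _ (u i) (y i) (y (i-1) * y (i+1)) (hy i (by omega)) (hm i (by omega))
      (fun z hz => by
        obtain ⟨i, rfl⟩ : ∃ l, i = l + 1 := ⟨i - 1, by omega⟩
        have a := hup (i+1) (by omega) z hz
        have b := hdn i (by omega) z hz
        simp only [Polynomial.IsRoot] at a b ⊢
        simp [a, b])
  have hn1 : (∃ t, Wr t (y (m+1)) = y m * y (m+2) ^ 2) ↔ _ :=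
    key _ (u (m+1)) (y (m+1)) (y m * y (m+2) ^ 2) (hy _ (by omega)) (hm _ (by omega))
      (fun z hz => by
        have a := hup (m+1) (by omega) z hz
        have b := hdn m (by omega) z hz
        simp only [Polynomial.IsRoot] at a b ⊢
        simp [a, b])
  have hn2 : (∃ t, Wr t (y (m+2)) = y (m+1)) ↔ _ :=
    key _ (u (m+2)) (y (m+2)) (y (m+1)) (hy _ (by omega)) (hm _ (by omega))
      (fun z hz => hdn (m+1) (by omega) z hz)
  have hF : FertileT (m+2) y ↔ (∃ t, Wr t (y 0) = (y 1) ^ 2) ∧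
      (∀ i, 1 ≤ i → i ≤ m → ∃ t, Wr t (y i) = y (i-1) * y (i+1)) ∧
      (∃ t, Wr t (y (m+1)) = y m * y (m+2) ^ 2) ∧ (∃ t, Wr t (y (m+2)) = y (m+1)) := by
    constructor
    · rintro ⟨t, a, b, c, d⟩
      exact ⟨⟨_, a⟩, fun i h1 h2 => ⟨_, b i h1 h2⟩, ⟨_, c⟩, ⟨_, d⟩⟩
    · rintro ⟨⟨t0, a⟩, b, ⟨t1, c⟩, ⟨t2, d⟩⟩
      choose! T hT using b
      refine ⟨fun i => if i = 0 then t0 else if i ≤ m then T i else if i = m + 1 then t1 else t2,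
        ?_, ?_, ?_, ?_⟩
      · simpa using a
      · intro i h1 h2
        have h3 : i ≠ 0 := by omega
        have h4 : i ≤ m := h2
        simpa [h3, h4] using hT i h1 h2
      · simpa using c
      · simpa using d
  rw [hF]
  unfold IsCritical
  rw [e1, e2]
  refine and_congr ?_ (and_congr ?_ (and_congr ?_ ?_))
  · rw [h0]
    refine forall₂_congr fun j hj => ?_
    have hz := hroot 0 (by omega) j hj
    obtain ⟨a1, a2⟩ := logd_prod _ (u 1) (y 1) (hy 1 (by omega)) _ (hup 0 (by omega) _ hz)
    rw [eq_div_iff (by simpa using a1)]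
    simp only [sum_const_div _ 2, Polynomial.derivative_pow, Polynomial.eval_mul,
      Polynomial.eval_pow, Polynomial.eval_C, a2]
    generalize (∑ s ∈ (Finset.Icc 1 (k 0)).erase j, 1 / (u 0 j - u 0 s)) = A
    generalize (∑ l ∈ Finset.Icc 1 (k 1), 1 / (u 0 j - u 1 l)) = B
    generalize (y 1).eval (u 0 j) = p at *
    constructor
    · intro h
      push_cast
      linear_combination p ^ 2 * h
    · intro h
      push_cast at h
      refine mul_left_cancel₀ (pow_ne_zero 2 a1) ?_
      linear_combination h
  · refine forall₃_congr fun i h1 h2 => ?_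
    rw [hi i h1 h2]
    refine forall₂_congr fun j hj => ?_
    obtain ⟨i, rfl⟩ : ∃ l, i = l + 1 := ⟨i - 1, by omega⟩
    have e3 : i + 1 - 1 = i := rfl
    rw [e3]
    have hz := hroot (i+1) (by omega) j hj
    obtain ⟨a1, a2⟩ := logd_prod _ (u (i+1+1)) (y (i+1+1)) (hy _ (by omega)) _
      (hup (i+1) (by omega) _ hz)
    obtain ⟨b1, b2⟩ := logd_prod _ (u i) (y i) (hy _ (by omega)) _ (hdn i (by omega) _ hz)
    rw [eq_div_iff (by simpa using ⟨b1, a1⟩)]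
    simp only [sum_const_div _ 2, sum_const_div _ 4, Polynomial.derivative_mul,
      Polynomial.eval_mul, Polynomial.eval_add, a2, b2]
    generalize (∑ s ∈ (Finset.Icc 1 (k (i+1))).erase j, 1 / (u (i+1) j - u (i+1) s)) = A
    generalize (∑ l ∈ Finset.Icc 1 (k (i+1+1)), 1 / (u (i+1) j - u (i+1+1) l)) = B
    generalize (∑ l ∈ Finset.Icc 1 (k i), 1 / (u (i+1) j - u i l)) = D
    generalize (y (i+1+1)).eval (u (i+1) j) = p at *
    generalize (y i).eval (u (i+1) j) = q at *
    constructor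
    · intro h
      linear_combination p * q / 2 * h
    · intro h
      refine mul_left_cancel₀ (mul_ne_zero a1 b1) ?_
      linear_combination 2 * h
  · rw [hn1]
    refine forall₂_congr fun j hj => ?_
    have hz := hroot (m+1) (by omega) j hj
    obtain ⟨a1, a2⟩ := logd_prod _ (u (m+2)) (y (m+2)) (hy _ (by omega)) _
      (hup (m+1) (by omega) _ hz)
    obtain ⟨b1, b2⟩ := logd_prod _ (u m) (y m) (hy _ (by omega)) _ (hdn m (by omega) _ hz)
    rw [eq_div_iff (by simpa using ⟨b1, a1⟩)]
    simp only [sum_const_div _ 2, sum_const_div _ 4, Polynomial.derivative_mul,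
      Polynomial.derivative_pow, Polynomial.eval_pow, Polynomial.eval_C,
      Polynomial.eval_mul, Polynomial.eval_add, a2, b2]
    generalize (∑ s ∈ (Finset.Icc 1 (k (m+1))).erase j, 1 / (u (m+1) j - u (m+1) s)) = A
    generalize (∑ l ∈ Finset.Icc 1 (k (m+2)), 1 / (u (m+1) j - u (m+2) l)) = B
    generalize (∑ l ∈ Finset.Icc 1 (k m), 1 / (u (m+1) j - u m l)) = D
    generalize (y (m+2)).eval (u (m+1) j) = p at *
    generalize (y m).eval (u (m+1) j) = q at *
    constructor
    · intro h
      push_cast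
      linear_combination p ^ 2 * q / 2 * h
    · intro h
      push_cast at h
      refine mul_left_cancel₀ (mul_ne_zero (pow_ne_zero 2 a1) b1) ?_
      linear_combination 2 * h
  · rw [hn2]
    refine forall₂_congr fun j hj => ?_
    have hz := hroot (m+2) (by omega) j hj
    obtain ⟨b1, b2⟩ := logd_prod _ (u (m+1)) (y (m+1)) (hy _ (by omega)) _
      (hdn (m+1) (by omega) _ hz)
    rw [eq_div_iff b1]
    simp only [sum_const_div _ 8, sum_const_div _ 4, b2]
    generalize (∑ s ∈ (Finset.Icc 1 (k (m+2))).erase j, 1 / (u (m+2) j - u (m+2) s)) = A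
    generalize (∑ l ∈ Finset.Icc 1 (k (m+1)), 1 / (u (m+2) j - u (m+1) l)) = D
    generalize (y (m+1)).eval (u (m+2) j) = q at *
    constructor
    · intro h
      linear_combination q / 4 * h
    · intro h
      refine mul_left_cancel₀ b1 ?_
      linear_combination 4 * h
end
end

section
/- Let y = (y_0,…,y_n) be a generic fertile tuple of complex polynomials, let j ∈ {0,…,n}, and let ỹ_j ∈ ℂ[x] be any polynomial satisfying the j-th generation equation: Wr(ỹ_j,y_j) = y_1² if j = 0; Wr(ỹ_j,y_j) = y_{j−1}·y_{j+1} if 1 ≤ j ≤ n−2; Wr(ỹ_j,y_j) = y_{n−2}·y_n² if j = n−1; Wr(ỹ_j,y_j) = y_{n−1} if j = n. Then the tuple y^{(j)} obtained from y by replacing y_j with ỹ_j is fertile. -/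
/-!
Context: fix `n ≥ 2`.  `Wr`, `GenericT`, `FertileT`, and the `j`-th generation equation
`GenEq` are as in the paper (type `A_{2n}^{(2)}`).

STATEMENT 12: let `y = (y_0,…,y_n)` be a generic fertile tuple, `j ∈ {0,…,n}`, and let
`q = ỹ_j` satisfy the `j`-th generation equation.  Then the tuple obtained from `y` by
replacing `y_j` with `ỹ_j` is fertile.
-/

noncomputable section

/-- The `j`-th generation equation for a candidate polynomial `q` (to replace `y_j`):
`Wr(q,y_0) = y_1²` if `j = 0`; `Wr(q,y_j) = y_{j−1}·y_{j+1}` if `1 ≤ j ≤ n−2`;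
`Wr(q,y_{n−1}) = y_{n−2}·y_n²` if `j = n−1`; `Wr(q,y_n) = y_{n−1}` if `j = n`. -/
def GenEq (n : ℕ) (y : ℕ → Polynomial ℂ) (j : ℕ) (q : Polynomial ℂ) : Prop :=
  if j = 0 then Wr q (y 0) = (y 1) ^ 2
  else if j = n - 1 then Wr q (y (n-1)) = y (n-2) * (y n) ^ 2
  else if j = n then Wr q (y n) = y (n-1)
  else Wr q (y j) = y (j-1) * y (j+1)

open Polynomial in
lemma exists_antideriv_s12 (f : Polynomial ℂ) : ∃ k : Polynomial ℂ, derivative k = f := by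
  induction f using Polynomial.induction_on' with
  | add p q hp hq =>
    obtain ⟨a, ha⟩ := hp
    obtain ⟨b, hb⟩ := hq
    exact ⟨a + b, by simp [ha, hb]⟩
  | monomial n a =>
    refine ⟨monomial (n+1) (a / (n+1)), ?_⟩
    rw [derivative_monomial]
    have : (n:ℂ) + 1 ≠ 0 := by exact_mod_cast Nat.succ_ne_zero n
    congr 1
    push_cast
    field_simp

open Polynomial in
lemma exists_of_dvd (y F : Polynomial ℂ) (hy : IsCoprime y (derivative y))
    (h : y ∣ derivative F * derivative y - F * derivative (derivative y)) :
    ∃ g, Wr g y = F := by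
  obtain ⟨a, b, hab⟩ := hy
  -- g0 = F b
  have h1 : y ∣ derivative (F * b) + F * a := by
    have hc : IsCoprime y (derivative y ^ 2) := IsCoprime.pow_right ⟨a, b, hab⟩
    apply hc.dvd_of_dvd_mul_left
    obtain ⟨m, hm⟩ := h
    have hd := congrArg derivative hab
    simp only [derivative_add, derivative_mul, derivative_one] at hd ⊢
    refine ⟨m * b * derivative y
      - F * derivative y * derivative a, ?_⟩
    linear_combination (b * derivative y) * hm + (F * derivative y) * hd
  obtain ⟨m, hm⟩ := h1
  obtain ⟨k, hk⟩ := exists_antideriv_s12 (-m)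
  refine ⟨F * b + y * k, ?_⟩
  unfold Wr
  simp only [derivative_add, derivative_mul] at hm ⊢
  rw [hk]
  linear_combination F * hab - y * hm

open Polynomial in
lemma key_s12 (y p q A : Polynomial ℂ) (hy : IsCoprime y (derivative y)) (hc : IsCoprime y p)
    (hd : y ∣ Wr q p) (h : ∃ g, Wr g y = A * p) : ∃ g, Wr g y = A * q := by
  obtain ⟨g, hg⟩ := h
  apply exists_of_dvd _ _ hy
  apply hc.dvd_of_dvd_mul_left
  obtain ⟨m, hm⟩ := hd
  unfold Wr at hg hm
  have hg' := congrArg derivative hg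
  simp only [derivative_sub, derivative_mul] at hg' ⊢
  refine ⟨q * (derivative g * derivative (derivative y) - derivative (derivative g) * derivative y)
    - A * m * derivative y, ?_⟩
  linear_combination (-q * derivative y) * hg' + q * derivative (derivative y) * hg
    - A * derivative y * hm

lemma key2 (y p q A : Polynomial ℂ) (hy : IsCoprime y (Polynomial.derivative y))
    (hc : IsCoprime y p)
    (hd : y ∣ Wr q p) (h : ∃ g, Wr g y = A * p ^ 2) : ∃ g, Wr g y = A * q ^ 2 := by
  have h1 := key_s12 y p q (A * p) hy hc hd (by simpa [pow_two, mul_assoc] using h)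
  have h2 := key_s12 y p q (A * q) hy hc hd (by simpa [mul_assoc, mul_comm, mul_left_comm] using h1)
  simpa [pow_two, mul_assoc] using h2

lemma fertile_iff (n : ℕ) (hn : 2 ≤ n) (y : ℕ → Polynomial ℂ) :
    FertileT n y ↔ ∀ i ≤ n, ∃ g, GenEq n y i g := by
  constructor
  · rintro ⟨ty, h0, h1, h2, h3⟩ i hi
    refine ⟨ty i, ?_⟩
    unfold GenEq
    split_ifs with a b c
    · rw [a]; exact h0
    · rw [b]; exact h2
    · rw [c]; exact h3
    · exact h1 i (by omega) (by omega)
  · intro h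
    choose! ty hty using h
    refine ⟨ty, ?_, ?_, ?_, ?_⟩
    · simpa [GenEq] using hty 0 (by omega)
    · intro i h1 h2
      have := hty i (by omega)
      unfold GenEq at this
      rwa [if_neg (by omega), if_neg (by omega), if_neg (by omega)] at this
    · have := hty (n-1) (by omega)
      unfold GenEq at this
      rwa [if_neg (by omega), if_pos rfl] at this
    · have := hty n (by omega)
      unfold GenEq at this
      rwa [if_neg (by omega), if_neg (by omega), if_pos rfl] at this

lemma Wr_neg_swap (f g : Polynomial ℂ) : Wr (-f) g = Wr g f := by
  simp only [Wr, Polynomial.derivative_neg]; ring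

lemma isCoprime_of_roots (f g : Polynomial ℂ) (h : ∀ z, ¬ (f.IsRoot z ∧ g.IsRoot z)) :
    IsCoprime f g := by
  rw [Polynomial.isCoprime_iff_aeval_ne_zero_of_isAlgClosed ℂ ℂ]
  intro z
  have := h z
  simp only [Polynomial.IsRoot, Polynomial.coe_aeval_eq_eval] at this ⊢
  tauto

/-- neighbours divide the right-hand side -/
lemma dvd_of_genEq (n : ℕ) (hn : 2 ≤ n) (y : ℕ → Polynomial ℂ) (j i : ℕ) (hj : j ≤ n)
    (hi : i ≤ n) (q : Polynomial ℂ) (hq : GenEq n y j q) (hij : i = j + 1 ∨ j = i + 1) :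
    y i ∣ Wr q (y j) := by
  unfold GenEq at hq
  split_ifs at hq with a b c
  · obtain rfl : i = 1 := by omega
    rw [a, hq]; exact dvd_pow_self _ two_ne_zero
  · rw [b, hq]
    rcases hij with h | h
    · obtain rfl : i = n := by omega
      exact Dvd.dvd.mul_left (dvd_pow_self _ two_ne_zero) _
    · obtain rfl : i = n - 2 := by omega
      exact dvd_mul_right _ _
  · obtain rfl : i = n - 1 := by omega
    rw [c, hq]
  · rw [hq]
    rcases hij with h | h
    · rw [h]; exact dvd_mul_left _ _
    · obtain rfl : i = j - 1 := by omega
      exact dvd_mul_right _ _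

theorem stmt12 (n : ℕ) (hn : 2 ≤ n) (y : ℕ → Polynomial ℂ)
    (hgen : GenericT n y) (hfert : FertileT n y)
    (j : ℕ) (hj : j ≤ n) (q : Polynomial ℂ) (hq : GenEq n y j q) :
    FertileT n (Function.update y j q) := by
  rw [fertile_iff n hn] at hfert ⊢
  obtain ⟨hne, hmul, hcom⟩ := hgen
  intro i hi
  have hsep : IsCoprime (y i) (Polynomial.derivative (y i)) := by
    apply isCoprime_of_roots
    intro z hz
    have := (Polynomial.one_lt_rootMultiplicity_iff_isRoot (hne i hi)).2 hz
    have := hmul i hi z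
    omega
  by_cases hij : i = j
  · subst hij
    refine ⟨-y i, ?_⟩
    unfold GenEq at hq ⊢
    split_ifs at hq ⊢ with a b c
    · subst a
      simpa [Wr_neg_swap] using hq
    · have e1 : n - 2 ≠ i := by omega
      have e2 : n ≠ i := by omega
      rw [← b] at hq ⊢
      simpa [Wr_neg_swap, e1, e2] using hq
    · subst c
      have e1 : i - 1 ≠ i := by omega
      simpa [Wr_neg_swap, e1] using hq
    · have e1 : i - 1 ≠ i := by omega
      simpa [Wr_neg_swap, e1] using hq
  have hf := hfert i hi
  by_cases hadj : i = j + 1 ∨ j = i + 1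
  · have hd := dvd_of_genEq n hn y j i hj hi q hq hadj
    have hc : IsCoprime (y i) (y j) := by
      rcases hadj with h | h
      · subst h
        exact (isCoprime_of_roots _ _ (hcom j (by omega))).symm
      · subst h
        exact isCoprime_of_roots _ _ (hcom i (by omega))
    have k1 := fun A => key_s12 (y i) (y j) q A hsep hc hd
    have k2 := fun A => key2 (y i) (y j) q A hsep hc hd
    unfold GenEq at hf ⊢
    split_ifs at hf ⊢ with a b c
    · subst a
      obtain rfl : j = 1 := by omega
      simpa using k2 1 (by simpa using hf)
    · rw [← b] at hf ⊢
      rcases hadj with h | h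
      · obtain rfl : j = n - 2 := by omega
        have e1 : n ≠ n - 2 := by omega
        simpa [hij, e1, mul_comm] using k1 (y n ^ 2) (by simpa [mul_comm] using hf)
      · obtain rfl : j = n := by omega
        have e1 : j - 2 ≠ j := by omega
        simpa [hij, e1] using k2 (y (j-2)) hf
    · subst c
      obtain rfl : j = i - 1 := by omega
      simpa [hij] using k1 1 (by simpa using hf)
    · rcases hadj with h | h
      · obtain rfl : j = i - 1 := by omega
        have e1 : i + 1 ≠ i - 1 := by omega
        simpa [hij, e1, mul_comm] using k1 (y (i+1)) (by simpa [mul_comm] using hf)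
      · subst h
        have e1 : i - 1 ≠ i + 1 := by omega
        simpa [hij, e1] using k1 (y (i-1)) hf
  · have e0 : ∀ m, m ≠ j → Function.update y j q m = y m := fun m hm => by simp [hm]
    obtain ⟨g, hg⟩ := hf
    refine ⟨g, ?_⟩
    unfold GenEq at hg ⊢
    split_ifs at hg ⊢ with a b c
    · rwa [e0 0 (by omega), e0 1 (by omega)]
    · rwa [e0 (n-1) (by omega), e0 (n-2) (by omega), e0 n (by omega)]
    · rwa [e0 n (by omega), e0 (n-1) (by omega)]
    · rwa [e0 i (by omega), e0 (i-1) (by omega), e0 (i+1) (by omega)]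
end
end

section
/- Let y = (y_0,…,y_n) be a generic fertile tuple of complex polynomials, let j ∈ {0,…,n}, and let ỹ_j ∈ ℂ[x] satisfy the j-th generation equation: Wr(ỹ_j,y_j) = y_1² if j = 0; Wr(ỹ_j,y_j) = y_{j−1}·y_{j+1} if 1 ≤ j ≤ n−2; Wr(ỹ_j,y_j) = y_{n−2}·y_n² if j = n−1; Wr(ỹ_j,y_j) = y_{n−1} if j = n. Then the set of c ∈ ℂ for which the tuple obtained from y by replacing y_j with ỹ_j + c·y_j is NOT generic is finite. -/
/-!
Context: fix `n ≥ 2`.  `Wr`, `GenericT`, `FertileT`, and the `j`-th generation equation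
`GenEq` are as in the paper (type `A_{2n}^{(2)}`).  The general solution of the `j`-th
generation equation is `ỹ_j + c·y_j`, `c ∈ ℂ`.

STATEMENT 13: let `y = (y_0,…,y_n)` be a generic fertile tuple, `j ∈ {0,…,n}`, and let
`q = ỹ_j` satisfy the `j`-th generation equation.  Then the set of `c ∈ ℂ` for which the
tuple obtained from `y` by replacing `y_j` with `ỹ_j + c·y_j` is NOT generic is finite.
-/

noncomputable section

theorem stmt13 (n : ℕ) (hn : 2 ≤ n) (y : ℕ → Polynomial ℂ)
    (hgen : GenericT n y) (hfert : FertileT n y)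
    (j : ℕ) (hj : j ≤ n) (q : Polynomial ℂ) (hq : GenEq n y j q) :
    {c : ℂ | ¬ GenericT n (Function.update y j (q + Polynomial.C c * y j))}.Finite := by
  obtain ⟨h0, h1, h2⟩ := hgen
  have key : ∃ W : Polynomial ℂ, W ≠ 0 ∧ Wr q (y j) = W ∧
      (∀ z, W.IsRoot z → ¬ (y j).IsRoot z) ∧
      (∀ i, i < n → i + 1 = j → ∀ z, (y i).IsRoot z → W.IsRoot z) ∧
      (j < n → ∀ z, (y (j+1)).IsRoot z → W.IsRoot z) := by
    unfold GenEq at hq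
    split_ifs at hq with c1 c2 c3
    · subst c1
      refine ⟨_, pow_ne_zero 2 (h0 1 (by omega)), hq, ?_, ?_, ?_⟩
      · intro z hz hy
        exact h2 0 (by omega) z ⟨hy, by simpa [Polynomial.IsRoot] using hz⟩
      · intro i hi hh; omega
      · intro _ z hz
        simpa [Polynomial.IsRoot] using hz
    · obtain ⟨m, rfl⟩ : ∃ m, n = m + 2 := ⟨n - 2, by omega⟩
      have hj1 : j = m + 1 := by omega
      subst hj1
      have e1 : m + 2 - 1 = m + 1 := by omega
      have e2 : m + 2 - 2 = m := by omega
      rw [e1, e2] at hq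
      refine ⟨_, mul_ne_zero (h0 m (by omega)) (pow_ne_zero 2 (h0 (m+2) le_rfl)), hq, ?_, ?_, ?_⟩
      · intro z hz hy
        simp only [Polynomial.IsRoot, Polynomial.eval_mul, Polynomial.eval_pow, mul_eq_zero,
          pow_eq_zero_iff, ne_eq, OfNat.ofNat_ne_zero, not_false_eq_true] at hz
        rcases hz with hz | hz
        · exact h2 m (by omega) z ⟨hz, hy⟩
        · exact h2 (m+1) (by omega) z ⟨hy, hz⟩
      · intro i hi hh z hz
        obtain rfl : i = m := by omega
        simp only [Polynomial.IsRoot] at hz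
        simp [Polynomial.IsRoot, hz]
      · intro _ z hz
        simp only [Polynomial.IsRoot] at hz
        simp [Polynomial.IsRoot, hz]
    · subst c3
      obtain ⟨m, rfl⟩ : ∃ m, j = m + 1 := ⟨j - 1, by omega⟩
      rw [Nat.add_sub_cancel] at hq
      refine ⟨_, h0 m (by omega), hq, ?_, ?_, ?_⟩
      · intro z hz hy
        exact h2 m (by omega) z ⟨hz, hy⟩
      · intro i hi hh z hz
        obtain rfl : i = m := by omega
        exact hz
      · intro h; omega
    · obtain ⟨m, rfl⟩ : ∃ m, j = m + 1 := ⟨j - 1, by omega⟩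
      rw [Nat.add_sub_cancel] at hq
      refine ⟨_, mul_ne_zero (h0 m (by omega)) (h0 (m+1+1) (by omega)), hq, ?_, ?_, ?_⟩
      · intro z hz hy
        simp only [Polynomial.IsRoot, Polynomial.eval_mul, mul_eq_zero] at hz
        rcases hz with hz | hz
        · exact h2 m (by omega) z ⟨hz, hy⟩
        · exact h2 (m+1) (by omega) z ⟨hy, hz⟩
      · intro i hi hh z hz
        obtain rfl : i = m := by omega
        simp only [Polynomial.IsRoot] at hz
        simp [Polynomial.IsRoot, hz]
      · intro _ z hz
        simp only [Polynomial.IsRoot] at hz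
        simp [Polynomial.IsRoot, hz]
  obtain ⟨W, hW, hqW, hWy, hl, hr⟩ := key
  have hfin : ((fun z => -(q.eval z) / (y j).eval z) '' {z | W.IsRoot z}).Finite :=
    (Polynomial.finite_setOfPred_isRoot hW).image _
  refine hfin.subset ?_
  intro c hc
  by_contra hcn
  apply hc
  have hroot : ∀ z, W.IsRoot z → ¬ (q + Polynomial.C c * y j).IsRoot z := by
    intro z hz hp
    apply hcn
    refine ⟨z, hz, ?_⟩
    have hne : (y j).eval z ≠ 0 := hWy z hz
    simp only [Polynomial.IsRoot, Polynomial.eval_add, Polynomial.eval_mul,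
      Polynomial.eval_C] at hp
    show -(q.eval z) / (y j).eval z = c
    rw [div_eq_iff hne]
    linear_combination -hp
  have hWc : Wr (q + Polynomial.C c * y j) (y j) = W := by
    rw [← hqW]
    simp only [Wr, Polynomial.derivative_add, Polynomial.derivative_mul, Polynomial.derivative_C]
    ring
  have hpne : q + Polynomial.C c * y j ≠ 0 := by
    intro h
    rw [h] at hWc
    apply hW
    rw [← hWc]
    simp [Wr]
  refine ⟨?_, ?_, ?_⟩
  · intro i hi
    by_cases hij : i = j
    · subst hij
      simpa using hpne
    · rw [Function.update_of_ne hij]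
      exact h0 i hi
  · intro i hi z
    by_cases hij : i = j
    · subst hij
      rw [Function.update_self]
      by_contra hlt
      rw [not_le, Polynomial.one_lt_rootMultiplicity_iff_isRoot hpne] at hlt
      obtain ⟨ha, hb⟩ := hlt
      refine hroot z ?_ ha
      rw [← hWc]
      simp only [Polynomial.IsRoot] at ha hb ⊢
      simp only [Wr, Polynomial.eval_sub, Polynomial.eval_mul, ha, hb, zero_mul, sub_zero]
    · rw [Function.update_of_ne hij]
      exact h1 i hi z
  · intro i hi z
    by_cases hij : i = j
    · subst hij
      rw [Function.update_self, Function.update_of_ne (by omega)]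
      rintro ⟨ha, hb⟩
      exact hroot z (hr hi z hb) ha
    · rw [Function.update_of_ne hij]
      by_cases hij2 : i + 1 = j
      · subst hij2
        rw [Function.update_self]
        rintro ⟨ha, hb⟩
        exact hroot z (hl i hi rfl z ha) hb
      · rw [Function.update_of_ne hij2]
        exact h2 i hi z
end
end
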